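/- arXiv:1704.02720 — 5 statements merged into one kernel-verified Lean document; each statement's English description precedes it below -/
import Mathlib

section
/- Let $1<\alpha<2$, $\tau>0$, and for $l=0,1,2,\dots$ set $b_l=\frac{\tau^{2-\alpha}}{2-\alpha}\big[(l+1)^{2-\alpha}-l^{2-\alpha}\big]$, and $t_m=m\tau$. Then for every real number $q$, every real sequence $G_1,G_2,G_3,\dots$, and every integer $m\ge 1$, $\sum_{n=1}^{m}\Big[b_0G_n-\sum_{k=1}^{n-1}(b_{n-k-1}-b_{n-k})G_k-b_{n-1}q\Big]G_n \;\ge\; \frac{t_m^{1-\alpha}}{2}\,\tau\sum_{n=1}^{m}G_n^2-\frac{t_m^{2-\alpha}}{2(2-\alpha)}\,q^2$. -/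
open Finset

lemma tele_aux (d : ℕ → ℝ) (M : ℕ) :
    ∑ k ∈ Finset.Icc 1 M, (d (k + 1) - d k) = d (M + 1) - d 1 := by
  induction M with
  | zero => simp
  | succ M ih => rw [Finset.sum_Icc_succ_top (by omega), ih]; ring

lemma energy_aux (b : ℕ → ℝ) (hpos : ∀ l, 0 ≤ b l) (hanti : ∀ l, b (l + 1) ≤ b l)
    (q : ℝ) (G : ℕ → ℝ) (m : ℕ) :
    (∑ k ∈ Finset.Icc 1 m, b (m - k) * G k ^ 2) / 2
        - (∑ n ∈ Finset.range m, b n) * q ^ 2 / 2 ≤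
    ∑ n ∈ Finset.Icc 1 m,
        (b 0 * G n - (∑ k ∈ Finset.Icc 1 (n - 1), (b (n - k - 1) - b (n - k)) * G k)
          - b (n - 1) * q) * G n := by
  induction m with
  | zero => simp
  | succ m ih =>
    rw [Finset.sum_Icc_succ_top (by omega), Finset.sum_Icc_succ_top (by omega),
      Finset.sum_range_succ]
    simp only [Nat.add_sub_cancel, Nat.sub_self]
    have ht : ∑ k ∈ Finset.Icc 1 m, (b (m + 1 - k - 1) - b (m + 1 - k)) = b 0 - b m := by
      have := tele_aux (fun k => b (m + 1 - k)) m
      simpa [Nat.sub_sub] using this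
    have h1 : (∑ k ∈ Finset.Icc 1 m, (b (m + 1 - k - 1) - b (m + 1 - k)) * G k) * G (m + 1)
        ≤ ∑ k ∈ Finset.Icc 1 m, ((b (m - k) * G k ^ 2) / 2 - (b (m + 1 - k) * G k ^ 2) / 2
          + (b (m + 1 - k - 1) - b (m + 1 - k)) * (G (m + 1) ^ 2 / 2)) := by
      rw [Finset.sum_mul]
      apply Finset.sum_le_sum
      intro k hk
      rw [Finset.mem_Icc] at hk
      have e1 : m + 1 - k - 1 = m - k := by omega
      have e2 : m + 1 - k = (m - k) + 1 := by omega
      rw [e1, e2]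
      have := hanti (m - k)
      nlinarith [mul_nonneg (sub_nonneg.2 this) (sq_nonneg (G k - G (m + 1)))]
    rw [Finset.sum_add_distrib, Finset.sum_sub_distrib, ← Finset.sum_div, ← Finset.sum_div,
      ← Finset.sum_mul, ht] at h1
    have h2 := mul_nonneg (hpos m) (sq_nonneg (q - G (m + 1)))
    nlinarith

theorem stmt_0 (α τ : ℝ) (hα : 1 < α) (hα2 : α < 2) (hτ : 0 < τ)
    (b : ℕ → ℝ)
    (hb : ∀ l : ℕ, b l = τ ^ (2 - α) / (2 - α) * (((l : ℝ) + 1) ^ (2 - α) - (l : ℝ) ^ (2 - α)))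
    (q : ℝ) (G : ℕ → ℝ) (m : ℕ) (hm : 1 ≤ m) :
    ∑ n ∈ Finset.Icc 1 m,
        (b 0 * G n - (∑ k ∈ Finset.Icc 1 (n - 1), (b (n - k - 1) - b (n - k)) * G k)
          - b (n - 1) * q) * G n
      ≥ ((m : ℝ) * τ) ^ (1 - α) / 2 * τ * ∑ n ∈ Finset.Icc 1 m, (G n) ^ 2
        - ((m : ℝ) * τ) ^ (2 - α) / (2 * (2 - α)) * q ^ 2 := by
  have hc : 0 < 2 - α := by linarith
  have hC : 0 < τ ^ (2 - α) / (2 - α) := by positivity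
  have hpos : ∀ l, 0 ≤ b l := by
    intro l
    rw [hb]
    apply mul_nonneg hC.le
    rw [sub_nonneg]
    exact Real.rpow_le_rpow (by positivity) (by linarith) hc.le
  have hanti : ∀ l, b (l + 1) ≤ b l := by
    intro l
    rw [hb, hb]
    apply mul_le_mul_of_nonneg_left _ hC.le
    have := (Real.concaveOn_rpow hc.le (by linarith : 2 - α ≤ 1)).2
      (show (l : ℝ) ∈ Set.Ici 0 from Set.mem_Ici.2 (Nat.cast_nonneg l))
      (show (l : ℝ) + 2 ∈ Set.Ici 0 by simp only [Set.mem_Ici]; positivity)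
      (by norm_num : (0 : ℝ) ≤ 1 / 2) (by norm_num : (0 : ℝ) ≤ 1 / 2) (by norm_num)
    simp only [smul_eq_mul] at this
    rw [show (1 / 2 : ℝ) * l + 1 / 2 * (l + 2) = l + 1 by ring] at this
    push_cast
    rw [show (l : ℝ) + 1 + 1 = l + 2 by ring]
    linarith
  have hanti' : Antitone b := antitone_nat_of_succ_le hanti
  have hsum : ∑ n ∈ Finset.range m, b n = (m * τ) ^ (2 - α) / (2 - α) := by
    have : ∀ M : ℕ, ∑ n ∈ Finset.range M, b n = τ ^ (2 - α) / (2 - α) * (M : ℝ) ^ (2 - α) := by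
      intro M
      induction M with
      | zero => simp [Real.zero_rpow hc.ne']
      | succ M ih => rw [Finset.sum_range_succ, ih, hb]; push_cast; ring
    rw [this, Real.mul_rpow (by positivity) hτ.le]; ring
  have hm0 : (0 : ℝ) < m := by exact_mod_cast hm
  have hlow : (m * τ) ^ (1 - α) * τ ≤ b (m - 1) := by
    rw [hb, Nat.cast_sub hm]
    have hm1 : (1 : ℝ) ≤ m := by exact_mod_cast hm
    have hB := rpow_one_add_le_one_add_mul_self (s := -(1 / (m : ℝ)))
      (by rw [neg_le_neg_iff, div_le_one hm0]; exact hm1) hc.le (by linarith : 2 - α ≤ 1)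
    have hs : (0 : ℝ) ≤ 1 + -(1 / (m : ℝ)) := by
      have : 1 / (m : ℝ) ≤ 1 := by rw [div_le_one hm0]; exact hm1
      linarith
    have e : ((m : ℝ) - (1 : ℕ)) = m * (1 + -(1 / (m : ℝ))) := by
      field_simp; push_cast; ring
    have e1 : (m : ℝ) ^ (2 - α) = m ^ (1 - α) * m := by
      rw [← Real.rpow_add_one hm0.ne']; congr 1; ring
    have e2 : τ ^ (2 - α) = τ ^ (1 - α) * τ := by
      rw [← Real.rpow_add_one hτ.ne']; congr 1; ring
    have h3 : (2 - α) * (m : ℝ) ^ (1 - α) ≤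
        ((m : ℝ) - (1 : ℕ) + 1) ^ (2 - α) - ((m : ℝ) - (1 : ℕ)) ^ (2 - α) := by
      rw [show ((m : ℝ) - (1 : ℕ) + 1) = m by push_cast; ring, e, Real.mul_rpow hm0.le hs]
      have h4 := mul_le_mul_of_nonneg_left hB (Real.rpow_nonneg hm0.le (2 - α))
      have h5 : (m : ℝ) ^ (2 - α) * (1 + (2 - α) * -(1 / (m : ℝ)))
          = (m : ℝ) ^ (2 - α) - (2 - α) * (m : ℝ) ^ (1 - α) := by
        rw [e1]; field_simp; ring
      linarith
    calc (m * τ) ^ (1 - α) * τ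
        = τ ^ (2 - α) / (2 - α) * ((2 - α) * (m : ℝ) ^ (1 - α)) := by
          rw [Real.mul_rpow hm0.le hτ.le, e2]; field_simp
      _ ≤ _ := mul_le_mul_of_nonneg_left h3 hC.le
  have hS : (m * τ) ^ (1 - α) * τ * ∑ n ∈ Finset.Icc 1 m, (G n) ^ 2
      ≤ ∑ k ∈ Finset.Icc 1 m, b (m - k) * G k ^ 2 := by
    rw [Finset.mul_sum]
    apply Finset.sum_le_sum
    intro k hk
    rw [Finset.mem_Icc] at hk
    exact mul_le_mul_of_nonneg_right (hlow.trans (hanti' (by omega))) (sq_nonneg _)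
  have hE := energy_aux b hpos hanti q G m
  rw [hsum] at hE
  refine le_trans ?_ hE
  have e6 : (m * τ) ^ (2 - α) / (2 * (2 - α)) * q ^ 2
      = (m * τ) ^ (2 - α) / (2 - α) * q ^ 2 / 2 := by
    field_simp
  rw [e6]
  linarith
end

section
/- Let $M\ge 1$ be an integer, $L>0$, and $h=L/M$. For all real numbers $v_0,v_1,\dots,v_M$ with $v_0=v_M=0$, one has the one-dimensional discrete Poincar\'e inequality $h\sum_{i=1}^{M-1}v_i^2\;\le\;\frac{L^2}{6}\,h\sum_{i=1}^{M}\Big(\frac{v_i-v_{i-1}}{h}\Big)^2$. -/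
open Finset

lemma aux_cs (w : ℕ → ℝ) (n : ℕ) :
    (w n - w 0) ^ 2 ≤ n * ∑ k ∈ Finset.range n, (w (k + 1) - w k) ^ 2 := by
  rw [← Finset.sum_range_sub]
  have := sq_sum_le_card_mul_sum_sq (s := Finset.range n) (f := fun k => w (k + 1) - w k)
  simpa using this

lemma aux_sum (x : ℝ) (n : ℕ) :
    ∑ k ∈ Finset.range n, ((k : ℝ) + 1) * (x - (k + 1))
      = x * (n * (n + 1) / 2) - n * (n + 1) * (2 * n + 1) / 6 := by
  induction n with
  | zero => simp
  | succ n ih => rw [Finset.sum_range_succ, ih]; push_cast; ring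

lemma aux_icc (f : ℕ → ℝ) (n : ℕ) :
    ∑ i ∈ Finset.Icc 1 n, f i = ∑ k ∈ Finset.range n, f (k + 1) := by
  induction n with
  | zero => simp
  | succ n ih => rw [Finset.sum_range_succ, ← ih, Finset.sum_Icc_succ_top (by omega)]

theorem stmt_2 (M : ℕ) (hM : 1 ≤ M) (L : ℝ) (hL : 0 < L) (h : ℝ) (hh : h = L / M)
    (v : ℕ → ℝ) (hv0 : v 0 = 0) (hvM : v M = 0) :
    h * ∑ i ∈ Finset.Icc 1 (M - 1), (v i) ^ 2
      ≤ L ^ 2 / 6 * (h * ∑ i ∈ Finset.Icc 1 M, ((v i - v (i - 1)) / h) ^ 2) := by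
  obtain ⟨m, rfl⟩ : ∃ m, M = m + 1 := ⟨M - 1, by omega⟩
  have hMpos : (0 : ℝ) < ((m + 1 : ℕ) : ℝ) := by positivity
  have hpos : 0 < h := by rw [hh]; positivity
  have hLe : L = h * ((m + 1 : ℕ) : ℝ) := by rw [hh]; field_simp
  rw [aux_icc, aux_icc]
  simp only [Nat.add_sub_cancel, div_pow]
  rw [← Finset.sum_div]
  set D := ∑ k ∈ Finset.range (m + 1), (v (k + 1) - v k) ^ 2 with hD
  have hD0 : 0 ≤ D := Finset.sum_nonneg fun _ _ => sq_nonneg _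
  have key : ∀ k ∈ Finset.range m, ((m + 1 : ℕ) : ℝ) * v (k + 1) ^ 2
      ≤ (((k : ℝ) + 1) * (((m + 1 : ℕ) : ℝ) - (k + 1))) * D := by
    intro k hk
    obtain ⟨j, rfl⟩ : ∃ j, m = k + j := ⟨m - k, by have := Finset.mem_range.mp hk; omega⟩
    have h1 := aux_cs v (k + 1)
    have h2 := aux_cs (fun i => v (k + 1 + i)) j
    have e : k + 1 + j = k + j + 1 := by omega
    have hs : D = ∑ i ∈ Finset.range (k + 1), (v (i + 1) - v i) ^ 2
        + ∑ i ∈ Finset.range j, (v (k + 1 + (i + 1)) - v (k + 1 + i)) ^ 2 := by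
      rw [hD, ← e, Finset.sum_range_add]
      simp only [add_assoc]
    simp only [e, hvM, add_zero, hv0, zero_sub, sub_zero, neg_sq] at h1 h2
    simp only [add_assoc] at h1 h2 hs ⊢
    rw [hs]
    push_cast at h1 h2 ⊢
    have := mul_le_mul_of_nonneg_left h1 (Nat.cast_nonneg (α := ℝ) j)
    have := mul_le_mul_of_nonneg_left h2 (by positivity : (0:ℝ) ≤ (k:ℝ) + 1)
    nlinarith
  have hsum := Finset.sum_le_sum key
  rw [← Finset.mul_sum, ← Finset.sum_mul, aux_sum] at hsum
  set S := ∑ k ∈ Finset.range m, v (k + 1) ^ 2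
  have hS : S ≤ ((m + 1 : ℕ) : ℝ) ^ 2 / 6 * D := by
    refine le_of_mul_le_mul_left (hsum.trans ?_) hMpos
    rw [← mul_assoc]
    refine mul_le_mul_of_nonneg_right ?_ hD0
    push_cast
    nlinarith [Nat.cast_nonneg (α := ℝ) m]
  calc h * S ≤ h * (((m + 1 : ℕ) : ℝ) ^ 2 / 6 * D) := mul_le_mul_of_nonneg_left hS hpos.le
    _ = _ := by rw [hLe]; field_simp
end

section
/- Let $1<\beta<2$, $\tau>0$, $n\ge1$ an integer, $t_k=k\tau$, and let $v:[0,t_n]\to\mathbb{R}$ be three times continuously differentiable. Define the Caputo fractional derivative ${}_0^CD_t^{\beta}v(t)=\frac{1}{\Gamma(2-\beta)}\int_0^t(t-\xi)^{1-\beta}v''(\xi)\,d\xi$, the coefficients $a_k^{(\beta)}=(k+1)^{2-\beta}-k^{2-\beta}$, and $\delta_t v^{k-1/2}=(v(t_k)-v(t_{k-1}))/\tau$. Then $\Big|\frac{1}{2}\big({}_0^CD_t^{\beta}v(t_n)+{}_0^CD_t^{\beta}v(t_{n-1})\big)-\frac{\tau^{1-\beta}}{\Gamma(3-\beta)}\Big[a_0^{(\beta)}\delta_t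 v^{n-1/2}-\sum_{k=1}^{n-1}\big(a_{n-k-1}^{(\beta)}-a_{n-k}^{(\beta)}\big)\delta_t v^{k-1/2}-a_{n-1}^{(\beta)}v'(0)\Big]\Big|\;\le\;\frac{1}{\Gamma(3-\beta)}\Big[\frac{2-\beta}{12}+\frac{2^{3-\beta}}{3-\beta}-(1+2^{1-\beta})+\frac{1}{12}\Big]\max_{0\le t\le t_n}|v'''(t)|\,\tau^{3-\beta}$. -/
open Finset

/-- The Caputo fractional derivative of order β (for 1 < β < 2) of a function `v`
with second derivative `v''`, evaluated at time `t`. -/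
noncomputable def caputoDeriv (β : ℝ) (v'' : ℝ → ℝ) (t : ℝ) : ℝ :=
  (1 / Real.Gamma (2 - β)) * ∫ ξ in (0:ℝ)..t, (t - ξ) ^ (1 - β) * v'' ξ

open MeasureTheory intervalIntegral

lemma aux_int {α r C : ℝ} (hα0 : 0 < α) (hα1 : α < 1) (hr : 0 ≤ r) {ψ : ℝ → ℝ}
    (hψ : ContinuousOn ψ (Set.Icc 0 1)) (hb : ∀ y ∈ Set.Icc (0:ℝ) 1, |ψ y| ≤ C * y) :
    IntervalIntegrable (fun y => ψ y * (r + y) ^ (-α - 1)) volume 0 1 := by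
  have h1 : IntervalIntegrable (fun y : ℝ => C * y ^ (-α)) volume 0 1 :=
    (intervalIntegral.intervalIntegrable_rpow' (by linarith)).const_mul C
  refine h1.mono_fun ?_ ?_
  · rw [Set.uIoc_of_le zero_le_one]
    refine ContinuousOn.aestronglyMeasurable ?_ measurableSet_Ioc
    refine (hψ.mono Set.Ioc_subset_Icc_self).mul ?_
    refine ContinuousOn.rpow_const (by fun_prop) ?_
    intro x hx
    left
    have := hx.1
    positivity
  · rw [Set.uIoc_of_le zero_le_one]
    refine (ae_restrict_iff' measurableSet_Ioc).2 (Filter.Eventually.of_forall ?_)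
    intro y hy
    have hy0 : 0 < y := hy.1
    have hC := hb y ⟨hy0.le, hy.2⟩
    have hp : 0 < (r + y) ^ (-α - 1) := by positivity
    have hC0 : 0 ≤ C := by
      by_contra hc
      push Not at hc
      have := abs_nonneg (ψ y)
      nlinarith
    show ‖ψ y * (r + y) ^ (-α - 1)‖ ≤ ‖C * y ^ (-α)‖
    rw [Real.norm_eq_abs, Real.norm_eq_abs, abs_mul, abs_of_pos hp, abs_of_nonneg (a := C * y ^ (-α)) (by positivity)]
    have e1 : y ^ (-α) = y * y ^ (-α - 1) := by
      rw [← Real.rpow_one_add' hy0.le (by linarith)]; congr 1; ring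
    have e2 : (r + y) ^ (-α - 1) ≤ y ^ (-α - 1) :=
      Real.rpow_le_rpow_of_nonpos hy0 (by linarith) (by linarith)
    calc |ψ y| * (r + y) ^ (-α - 1) ≤ (C * y) * y ^ (-α - 1) := by gcongr
      _ = C * y ^ (-α) := by rw [e1]; ring

lemma aux_int2 {α r : ℝ} (hα1 : α < 1) (hr : 0 ≤ r) {ψ : ℝ → ℝ}
    (hψ : ContinuousOn ψ (Set.Icc 0 1)) :
    IntervalIntegrable (fun y => (r + y) ^ (-α) * ψ y) volume 0 1 := by
  have h1 : IntervalIntegrable (fun y : ℝ => (r + y) ^ (-α)) volume 0 1 := by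
    have := (intervalIntegral.intervalIntegrable_rpow' (a := r) (b := r + 1)
      (show -1 < -α by linarith)).comp_add_left r
    simpa using this
  refine h1.mul_continuousOn ?_
  rwa [Set.uIcc_of_le zero_le_one]

/-- integration by parts -/
lemma aux_parts {α r C : ℝ} (hα0 : 0 < α) (hα1 : α < 1) (hr : 0 ≤ r) {ψ ψ' : ℝ → ℝ}
    (hψ : ∀ y ∈ Set.Icc (0:ℝ) 1, HasDerivAt ψ (ψ' y) y)
    (hψ' : ContinuousOn ψ' (Set.Icc 0 1)) (hb : ∀ y ∈ Set.Icc (0:ℝ) 1, |ψ y| ≤ C * y) :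
    ∫ y in (0:ℝ)..1, (r + y) ^ (-α) * ψ' y =
      (r + 1) ^ (-α) * ψ 1 + α * ∫ y in (0:ℝ)..1, ψ y * (r + y) ^ (-α - 1) := by
  have hc : ContinuousOn ψ (Set.Icc 0 1) := fun y hy => (hψ y hy).continuousAt.continuousWithinAt
  have i1 := aux_int hα0 hα1 hr hc hb
  have i2 := aux_int2 hα1 hr hψ'
  have hψ0 : ψ 0 = 0 := by
    have := hb 0 (by simp)
    simpa using this
  have key : ∫ y in (0:ℝ)..1, ((r + y) ^ (-α) * ψ' y - α * (ψ y * (r + y) ^ (-α - 1)))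
      = (r + 1) ^ (-α) * ψ 1 - (r + 0) ^ (-α) * ψ 0 := by
    refine intervalIntegral.integral_eq_sub_of_hasDerivAt_of_le (f := fun y => (r + y) ^ (-α) * ψ y)
      zero_le_one ?_ ?_ (i2.sub (i1.const_mul α))
    · intro y hy
      rcases eq_or_lt_of_le hy.1 with h0 | h0
      · subst h0
        have : Filter.Tendsto (fun y : ℝ => C * y ^ (1 - α)) (nhdsWithin 0 (Set.Icc 0 1)) (nhds 0) := by
          have h2 : ContinuousAt (fun y : ℝ => C * y ^ (1 - α)) 0 := by
            refine ContinuousAt.mul continuousAt_const ?_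
            exact Real.continuousAt_rpow_const _ _ (Or.inr (by linarith))
          have h3 := h2.tendsto
          rw [Real.zero_rpow (by linarith), mul_zero] at h3
          exact h3.mono_left nhdsWithin_le_nhds
        unfold ContinuousWithinAt
        show Filter.Tendsto (fun y => (r + y) ^ (-α) * ψ y) (nhdsWithin 0 (Set.Icc 0 1)) (nhds ((r + 0) ^ (-α) * ψ 0))
        rw [hψ0, mul_zero]
        refine squeeze_zero_norm' ?_ this
        filter_upwards [self_mem_nhdsWithin] with y hy
        rcases eq_or_lt_of_le hy.1 with h0 | h0
        · subst h0
          simp [hψ0, Real.zero_rpow (show (1 - α) ≠ 0 by linarith)]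
        · have hp : 0 < (r + y) ^ (-α) := by positivity
          rw [Real.norm_eq_abs, abs_mul, abs_of_pos hp]
          have e1 : y ^ (1 - α) = y * y ^ (-α) := by
            rw [← Real.rpow_one_add' h0.le (by linarith)]; congr 1
          have e2 : (r + y) ^ (-α) ≤ y ^ (-α) :=
            Real.rpow_le_rpow_of_nonpos h0 (by linarith) (by linarith)
          calc (r + y) ^ (-α) * |ψ y| ≤ y ^ (-α) * (C * y) := by
                gcongr
                exact hb y hy
            _ = C * y ^ (1 - α) := by rw [e1]; ring
      · refine ContinuousWithinAt.mul ?_ (hc y hy)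
        refine ContinuousAt.continuousWithinAt ?_
        exact ContinuousAt.rpow_const (by fun_prop) (Or.inl (by positivity))
    · intro y hy
      have hy0 := hy.1
      have h1 : HasDerivAt (fun y => (r + y) ^ (-α)) (1 * (-α) * (r + y) ^ (-α - 1)) y :=
        HasDerivAt.rpow_const ((hasDerivAt_id y).const_add r) (Or.inl (by positivity))
      refine HasDerivAt.congr_deriv (h1.mul (hψ y ⟨hy.1.le, hy.2.le⟩)) ?_
      ring
  rw [intervalIntegral.integral_sub i2 (i1.const_mul α), intervalIntegral.integral_const_mul, hψ0] at key
  linarith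

lemma aux_F {α r : ℝ} (hα0 : 0 < α) (hα1 : α < 1) (hr : 0 ≤ r) :
    (1 - α) * ∫ y in (0:ℝ)..1, (r + y) ^ (-α) = (r + 1) ^ (1 - α) - r ^ (1 - α) := by
  have : ∫ y in (0:ℝ)..1, (r + y) ^ (-α) = ∫ x in r..(r+1), x ^ (-α) := by
    rw [intervalIntegral.integral_comp_add_left (fun x : ℝ => x ^ (-α)) r]; simp
  rw [this, integral_rpow (Or.inl (by linarith))]
  have : (1 - α) ≠ 0 := by linarith
  rw [show -α + 1 = 1 - α by ring]
  field_simp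

/-- L1 on an interval -/
lemma aux_L1 {α r C : ℝ} (hα0 : 0 < α) (hα1 : α < 1) (hr : 0 ≤ r) {h h' : ℝ → ℝ}
    (hh : ∀ y ∈ Set.Icc (0:ℝ) 1, HasDerivAt h (h' y) y)
    (hh' : ContinuousOn h' (Set.Icc 0 1))
    (hb : ∀ y ∈ Set.Icc (0:ℝ) 1, |(1 - y) * h 0 + y * h 1 - h y| ≤ C * y) :
    -(1 - α) * ∫ y in (0:ℝ)..1, (r + y) ^ (-α) * h' y =
      ((r + 1) ^ (1 - α) - r ^ (1 - α)) * (h 0 - h 1) +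
      α * (1 - α) * ∫ y in (0:ℝ)..1, ((1 - y) * h 0 + y * h 1 - h y) * (r + y) ^ (-α - 1) := by
  have key := aux_parts hα0 hα1 hr (ψ := fun y => (1 - y) * h 0 + y * h 1 - h y)
    (ψ' := fun y => h 1 - h 0 - h' y) (C := C) ?_ (by fun_prop) hb
  · have i1 := aux_int2 hα1 hr hh'
    have i0 := aux_int2 (α := α) hα1 hr (ψ := fun _ => h 1 - h 0) (by fun_prop)
    simp only [mul_sub ((_ : ℝ) ^ (-α)) (h 1 - h 0)] at key
    rw [intervalIntegral.integral_sub i0 i1, intervalIntegral.integral_mul_const] at key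
    rw [← aux_F hα0 hα1 hr]
    simp only [one_mul, sub_self, zero_mul, zero_add, mul_zero] at key
    linear_combination (1 - α) * key
  · intro y hy
    have h1 : HasDerivAt (fun y : ℝ => (1 - y) * h 0 + y * h 1) (-1 * h 0 + 1 * h 1) y :=
      (((hasDerivAt_id y).const_sub 1).mul_const _).add ((hasDerivAt_id y).mul_const _)
    refine HasDerivAt.congr_deriv (h1.sub (hh y hy)) ?_
    ring

/-- trapezoid kernel integral -/
noncomputable def TT (α r : ℝ) : ℝ :=
  α * (1 - α) * ∫ y in (0:ℝ)..1, (y * (1 - y) / 2) * (r + y) ^ (-α - 1)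

lemma aux_intq {α r : ℝ} (hα0 : 0 < α) (hα1 : α < 1) (hr : 0 ≤ r) :
    IntervalIntegrable (fun y => (y * (1 - y) / 2) * (r + y) ^ (-α - 1)) volume 0 1 := by
  refine aux_int (C := 1) hα0 hα1 hr (by fun_prop) ?_
  rintro y ⟨h0, h1⟩
  rw [abs_of_nonneg (by have : 0 ≤ 1 - y := by linarith
                        positivity)]
  nlinarith

lemma aux_inty {α r : ℝ} (hα0 : 0 < α) (hα1 : α < 1) (hr : 0 ≤ r) :
    IntervalIntegrable (fun y => y * (r + y) ^ (-α - 1)) volume 0 1 := by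
  refine aux_int (C := 1) hα0 hα1 hr (by fun_prop) ?_
  rintro y ⟨h0, h1⟩
  rw [abs_of_nonneg h0, one_mul]

lemma aux_int1 {α r : ℝ} (hr : 0 < r) :
    IntervalIntegrable (fun y => (r + y) ^ (-α - 1)) volume 0 1 := by
  refine ContinuousOn.intervalIntegrable ?_
  rw [Set.uIcc_of_le zero_le_one]
  refine ContinuousOn.rpow_const (by fun_prop) ?_
  rintro x ⟨hx, _⟩
  left; positivity

lemma TT_nonneg {α r : ℝ} (hα0 : 0 < α) (hα1 : α < 1) (hr : 0 ≤ r) : 0 ≤ TT α r := by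
  have h1 : 0 < 1 - α := by linarith
  unfold TT
  refine mul_nonneg (by positivity) (intervalIntegral.integral_nonneg zero_le_one ?_)
  rintro y ⟨h0, h1⟩
  have : 0 ≤ 1 - y := by linarith
  positivity

lemma TT_eq {α r : ℝ} (hα0 : 0 < α) (hα1 : α < 1) (hr : 0 ≤ r) :
    TT α r = ((r + 1) ^ (2 - α) - r ^ (2 - α)) / (2 - α)
      - ((r + 1) ^ (1 - α) + r ^ (1 - α)) / 2 := by
  have hp := aux_parts hα0 hα1 hr (ψ := fun y => y * (1 - y) / 2) (ψ' := fun y => (1 - 2 * y) / 2)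
    (C := 1) ?_ (by fun_prop) ?_
  · have : ∫ y in (0:ℝ)..1, (1 - α) * ((r + y) ^ (-α) * ((1 - 2 * y) / 2)) =
      ((1 - 2 * 1) / 2 * (r + 1) ^ (1 - α) + (r + 1) ^ (2 - α) / (2 - α)) -
      ((1 - 2 * 0) / 2 * (r + 0) ^ (1 - α) + (r + 0) ^ (2 - α) / (2 - α)) := by
      refine intervalIntegral.integral_eq_sub_of_hasDerivAt_of_le
        (f := fun y => (1 - 2 * y) / 2 * (r + y) ^ (1 - α) + (r + y) ^ (2 - α) / (2 - α))
        zero_le_one ?_ ?_ ((aux_int2 hα1 hr (by fun_prop)).const_mul _)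
      · refine ContinuousOn.add (ContinuousOn.mul (by fun_prop) ?_) (ContinuousOn.div_const ?_ _)
        · exact ContinuousOn.rpow_const (by fun_prop) (fun x hx => Or.inr (by linarith))
        · exact ContinuousOn.rpow_const (by fun_prop) (fun x hx => Or.inr (by linarith))
      · intro y hy
        have hy0 := hy.1
        have h1 : HasDerivAt (fun y => (r + y) ^ (1 - α)) (1 * (1 - α) * (r + y) ^ (1 - α - 1)) y :=
          HasDerivAt.rpow_const ((hasDerivAt_id y).const_add r) (Or.inl (by positivity))
        have h2 : HasDerivAt (fun y => (r + y) ^ (2 - α)) (1 * (2 - α) * (r + y) ^ (2 - α - 1)) y :=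
          HasDerivAt.rpow_const ((hasDerivAt_id y).const_add r) (Or.inl (by positivity))
        have h3 : HasDerivAt (fun y : ℝ => (1 - 2 * y) / 2) (-(2 * 1) / 2) y :=
          (((hasDerivAt_id y).const_mul 2).const_sub 1).div_const 2
        refine HasDerivAt.congr_deriv ((h3.mul h1).add (h2.div_const (2 - α))) ?_
        rw [show 1 - α - 1 = -α by ring, show 2 - α - 1 = 1 - α by ring]
        have : 2 - α ≠ 0 := by linarith
        field_simp
        ring
    rw [intervalIntegral.integral_const_mul, hp] at this
    unfold TT
    simp only [add_zero] at this
    ring_nf at this ⊢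
    linarith
  · intro y hy
    have h := ((hasDerivAt_id y).mul ((hasDerivAt_id y).const_sub 1)).div_const 2
    refine HasDerivAt.congr_deriv (h) ?_
    simp only [id]; ring
  · rintro y ⟨h0, h1⟩
    have : 0 ≤ 1 - y := by linarith
    rw [abs_of_nonneg (by positivity)]
    nlinarith

/-- Z -/
lemma aux_Z {α r : ℝ} (hr : 0 < r) :
    α * ∫ y in (0:ℝ)..1, (r + y) ^ (-α - 1) = r ^ (-α) - (r + 1) ^ (-α) := by
  have : ∫ y in (0:ℝ)..1, α * (r + y) ^ (-α - 1) = -(r + 1) ^ (-α) - -(r + 0) ^ (-α) := by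
    refine intervalIntegral.integral_eq_sub_of_hasDerivAt
      (f := fun y => -(r + y) ^ (-α)) ?_ ((aux_int1 hr).const_mul _)
    intro y hy
    rw [Set.uIcc_of_le zero_le_one] at hy
    have hy0 := hy.1
    have h1 : HasDerivAt (fun y => (r + y) ^ (-α)) (1 * (-α) * (r + y) ^ (-α - 1)) y :=
      HasDerivAt.rpow_const ((hasDerivAt_id y).const_add r) (Or.inl (by positivity))
    refine HasDerivAt.congr_deriv (h1.neg) ?_
    ring
  rw [intervalIntegral.integral_const_mul] at this
  rw [this, add_zero]; ring

lemma aux_Y {α r : ℝ} (hα0 : 0 < α) (hα1 : α < 1) (hr : 0 ≤ r) :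
    α * (1 - α) * ∫ y in (0:ℝ)..1, y * (r + y) ^ (-α - 1) =
      (r + 1) ^ (1 - α) - r ^ (1 - α) - (1 - α) * (r + 1) ^ (-α) := by
  have hp := aux_parts hα0 hα1 hr (ψ := fun y => y) (ψ' := fun y => 1)
    (C := 1) (fun y _ => hasDerivAt_id y) (by fun_prop) ?_
  · rw [← aux_F hα0 hα1 hr]
    simp only [mul_one] at hp
    rw [hp]; ring
  · rintro y ⟨h0, h1⟩
    rw [abs_of_nonneg h0, one_mul]

lemma TT_tail {α r : ℝ} (hα0 : 0 < α) (hα1 : α < 1) (hr : 0 < r) :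
    TT α (r + 1) ≤ (1 - α) / 12 * (r ^ (-α) - (r + 1) ^ (-α)) := by
  have h1 : 0 < 1 - α := by linarith
  have a1 : ∫ y in (0:ℝ)..1, (y * (1 - y) / 2) * (r + 1 + y) ^ (-α - 1) ≤
      ∫ y in (0:ℝ)..1, (y * (1 - y) / 2) * (r + 1) ^ (-α - 1) := by
    refine intervalIntegral.integral_mono_on zero_le_one (aux_intq hα0 hα1 (by linarith))
      (by apply Continuous.intervalIntegrable; fun_prop) ?_
    rintro y ⟨h0, h1⟩
    have : 0 ≤ 1 - y := by linarith
    have e2 : (r + 1 + y) ^ (-α - 1) ≤ (r + 1) ^ (-α - 1) :=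
      Real.rpow_le_rpow_of_nonpos (by linarith) (by linarith) (by linarith)
    gcongr
  have a2 : ∫ y in (0:ℝ)..1, (y * (1 - y) / 2) * (r + 1) ^ (-α - 1) = (r + 1) ^ (-α - 1) / 12 := by
    rw [intervalIntegral.integral_mul_const]
    have : ∫ y in (0:ℝ)..1, (y * (1 - y) / 2) = 1 / 12 := by
      have : ∀ y : ℝ, y * (1 - y) / 2 = (y - y ^ 2) / 2 := fun y => by ring
      simp only [this]
      rw [intervalIntegral.integral_div, intervalIntegral.integral_sub (by simp) (by simp)]
      simp
      norm_num
    rw [this]; ring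
  have a3 : (r + 1) ^ (-α - 1) ≤ ∫ y in (0:ℝ)..1, (r + y) ^ (-α - 1) := by
    have : ∫ y in (0:ℝ)..1, (r + 1) ^ (-α - 1) ≤ ∫ y in (0:ℝ)..1, (r + y) ^ (-α - 1) := by
      refine intervalIntegral.integral_mono_on zero_le_one (by simp) (aux_int1 hr) ?_
      rintro y ⟨h0, h1⟩
      exact Real.rpow_le_rpow_of_nonpos (by linarith) (by linarith) (by linarith)
    simpa using this
  rw [← aux_Z hr]
  unfold TT
  calc _ ≤ α * (1 - α) * ((∫ y in (0:ℝ)..1, (r + y) ^ (-α - 1)) / 12) := by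
        gcongr
        linarith
    _ = _ := by ring

lemma TT_sum {α : ℝ} (hα0 : 0 < α) (hα1 : α < 1) (m : ℕ) :
    ∑ j ∈ range m, TT α (j : ℝ) ≤
      (1 - α) / 12 + (2:ℝ) ^ (2 - α) / (2 - α) - (1 + (2:ℝ) ^ (-α)) := by
  have h1 : 0 < 1 - α := by linarith
  have h2 : ∀ m : ℕ, ∑ j ∈ range (m + 2), TT α (j : ℝ) ≤
      (1 - α) / 12 * (1 - ((m : ℝ) + 1) ^ (-α)) + (2:ℝ) ^ (2 - α) / (2 - α) - (1 + (2:ℝ) ^ (-α)) := by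
    intro m
    induction m with
    | zero =>
      rw [sum_range_succ, sum_range_succ]
      simp only [range_zero, sum_empty, Nat.cast_zero, Nat.cast_one, zero_add, Real.one_rpow, sub_self,
        mul_zero]
      rw [TT_eq hα0 hα1 le_rfl, TT_eq hα0 hα1 zero_le_one]
      rw [Real.zero_rpow (by linarith), Real.zero_rpow (by linarith)]
      have : (2:ℝ) ^ (1 - α) = 2 * 2 ^ (-α) := by
        rw [← Real.rpow_one_add' (by norm_num) (by linarith)]; congr 1
      norm_num
      rw [this]
      apply le_of_eq
      ring
    | succ k ih =>
      rw [sum_range_succ]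
      have := TT_tail hα0 hα1 (r := (k:ℝ) + 1) (by positivity)
      push_cast
      rw [show (k:ℝ) + 2 = k + 1 + 1 by ring]
      linarith
  have h3 : ∑ j ∈ range m, TT α (j : ℝ) ≤ ∑ j ∈ range (m + 2), TT α (j : ℝ) := by
    refine sum_le_sum_of_subset_of_nonneg (by simp) ?_
    intro i _ _
    exact TT_nonneg hα0 hα1 (by positivity)
  have h4 := h2 m
  have h5 : (1 - α) / 12 * (1 - ((m : ℝ) + 1) ^ (-α)) ≤ (1 - α) / 12 * 1 := by
    gcongr
    have : 0 ≤ ((m : ℝ) + 1) ^ (-α) := by positivity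
    linarith
  linarith

lemma aux_moment0 {α r : ℝ} (hα0 : 0 < α) (hα1 : α < 1) (hr : 1 ≤ r) :
    ∫ y in (0:ℝ)..1, (r + y) ^ (-α - 1) ≤ 4 * ∫ y in (0:ℝ)..1, y * (r + y) ^ (-α - 1) := by
  have i1 := aux_int1 (α := α) (r := r) (by linarith)
  have i2 := aux_inty hα0 hα1 (r := r) (by linarith)
  set κ : ℝ := (r + 1/4) ^ (-α - 1) * (1 + 1/4) ^ 2 with hκ
  have hκ0 : 0 ≤ κ := by positivity
  have mono : ∀ y z : ℝ, 0 ≤ y → y ≤ z →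
      (r + y) ^ (-α - 1) * (1 + y) ^ 2 ≤ (r + z) ^ (-α - 1) * (1 + z) ^ 2 := by
    intro y z hy hyz
    have hry : 0 < r + y := by linarith
    have hrz : 0 < r + z := by linarith
    have e : ∀ x : ℝ, 0 < x → x ^ (-α - 1) = x ^ (1 - α) / x ^ 2 := by
      intro x hx
      rw [← Real.rpow_natCast, ← Real.rpow_sub hx]; congr 1; push_cast; ring
    rw [e _ hry, e _ hrz, div_mul_eq_mul_div, div_mul_eq_mul_div, mul_div_assoc, mul_div_assoc,
      ← div_pow, ← div_pow]
    have : (1 + y) / (r + y) ≤ (1 + z) / (r + z) := by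
      rw [div_le_div_iff₀ hry hrz]; nlinarith
    have h1y : 0 ≤ (1 + y) / (r + y) := by positivity
    gcongr
  have hint : IntervalIntegrable (fun y : ℝ => (4 * y - 1) / (1 + y) ^ 2) volume 0 1 := by
    refine ContinuousOn.intervalIntegrable ?_
    rw [Set.uIcc_of_le zero_le_one]
    refine ContinuousOn.div (by fun_prop) (by fun_prop) ?_
    rintro y ⟨h0, _⟩
    positivity
  have hlog : ∫ y in (0:ℝ)..1, (4 * y - 1) / (1 + y) ^ 2 =
      (4 * Real.log (1 + 1) + 5 * (1 + 1)⁻¹) - (4 * Real.log (1 + 0) + 5 * (1 + 0)⁻¹) := by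
    refine intervalIntegral.integral_eq_sub_of_hasDerivAt
      (f := fun y : ℝ => 4 * Real.log (1 + y) + 5 * (1 + y)⁻¹) ?_ hint
    intro y hy
    rw [Set.uIcc_of_le zero_le_one] at hy
    have hy0 : 1 + y ≠ 0 := by have := hy.1; positivity
    have h0 : HasDerivAt (fun y : ℝ => 1 + y) 1 y := (hasDerivAt_id y).const_add 1
    refine HasDerivAt.congr_deriv (((h0.log hy0).const_mul 4).add ((h0.inv hy0).const_mul 5)) ?_
    field_simp
    ring
  have hpos : 0 ≤ ∫ y in (0:ℝ)..1, (4 * y - 1) / (1 + y) ^ 2 := by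
    rw [hlog]
    have := Real.log_two_gt_d9
    norm_num
    linarith
  have hle : ∫ y in (0:ℝ)..1, κ * ((4 * y - 1) / (1 + y) ^ 2) ≤
      ∫ y in (0:ℝ)..1, (4 * (y * (r + y) ^ (-α - 1)) - (r + y) ^ (-α - 1)) := by
    refine intervalIntegral.integral_mono_on zero_le_one (hint.const_mul _)
      ((i2.const_mul _).sub i1) ?_
    rintro y ⟨h0, h1⟩
    have hy2 : 0 < (1 + y) ^ 2 := by positivity
    rw [mul_div_assoc', div_le_iff₀ hy2]
    rcases le_total y (1/4) with h | h
    · have := mono y (1/4) h0 h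
      rw [← hκ] at this
      nlinarith
    · have := mono (1/4) y (by norm_num) h
      rw [← hκ] at this
      nlinarith
  rw [intervalIntegral.integral_const_mul, intervalIntegral.integral_sub (i2.const_mul _) i1,
    intervalIntegral.integral_const_mul] at hle
  have := mul_nonneg hκ0 hpos
  linarith

lemma aux_c {α i : ℝ} (hα0 : 0 < α) (hα1 : α < 1) (hi : 0 ≤ i) :
    2 * (i + 1) ^ (1 - α) - i ^ (1 - α) - (i + 1 + 1) ^ (1 - α) =
     α * (1 - α) * ((∫ y in (0:ℝ)..1, y * (i + y) ^ (-α - 1))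
      + (∫ y in (0:ℝ)..1, (i + 1 + y) ^ (-α - 1))
      - ∫ y in (0:ℝ)..1, y * (i + 1 + y) ^ (-α - 1)) := by
  have h1 := aux_Y hα0 hα1 hi
  have h2 := aux_Y hα0 hα1 (r := i + 1) (by linarith)
  have h3 := aux_Z (α := α) (r := i + 1) (by linarith)
  linear_combination h2 - h1 - (1 - α) * h3

lemma aux_Ymono {α i : ℝ} (hα0 : 0 < α) (hα1 : α < 1) (hi : 0 ≤ i) :
    (∫ y in (0:ℝ)..1, y * (i + 1 + y) ^ (-α - 1)) ≤ ∫ y in (0:ℝ)..1, y * (i + y) ^ (-α - 1) := by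
  refine intervalIntegral.integral_mono_on zero_le_one (aux_inty hα0 hα1 (by linarith))
    (aux_inty hα0 hα1 hi) ?_
  rintro y ⟨h0, h1⟩
  rcases eq_or_lt_of_le h0 with h | h
  · subst h; simp
  · have : (i + 1 + y) ^ (-α - 1) ≤ (i + y) ^ (-α - 1) :=
      Real.rpow_le_rpow_of_nonpos (by linarith) (by linarith) (by linarith)
    gcongr

lemma aux_c_nonneg {α i : ℝ} (hα0 : 0 < α) (hα1 : α < 1) (hi : 0 ≤ i) :
    0 ≤ 2 * (i + 1) ^ (1 - α) - i ^ (1 - α) - (i + 1 + 1) ^ (1 - α) := by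
  rw [aux_c hα0 hα1 hi]
  have h1 : 0 < 1 - α := by linarith
  have h2 := aux_Ymono hα0 hα1 hi
  have h3 : 0 ≤ ∫ y in (0:ℝ)..1, (i + 1 + y) ^ (-α - 1) := by
    refine intervalIntegral.integral_nonneg zero_le_one ?_
    rintro y ⟨h0, h1⟩
    positivity
  refine mul_nonneg (by positivity) ?_
  linarith

/-- Chebyshev-type inequality -/
lemma aux_cheb {α i K : ℝ} (hα0 : 0 < α) (hα1 : α < 1) (hi : 0 ≤ i) {f : ℝ → ℝ}
    (hf : ConcaveOn ℝ (Set.Icc 0 1) f) (hfc : ContinuousOn f (Set.Icc 0 1)) (hf0 : f 0 = 0)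
    (hfpos : ∀ y ∈ Set.Icc (0:ℝ) 1, 0 ≤ f y) (hfK : ∀ y ∈ Set.Icc (0:ℝ) 1, f y ≤ K * y) :
    (2 * (i + 1) ^ (1 - α) - i ^ (1 - α) - (i + 1 + 1) ^ (1 - α)) * (∫ y in (0:ℝ)..1, f y) ≤
     α * (1 - α) * ((∫ y in (0:ℝ)..1, f y * (i + 1 + y) ^ (-α - 1))
       + ∫ y in (0:ℝ)..1, f y * (i + y) ^ (-α - 1)) := by
  have h1α : 0 < 1 - α := by linarith
  have hfa : ∀ y ∈ Set.Icc (0:ℝ) 1, |f y| ≤ K * y := fun y hy => by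
    rw [abs_of_nonneg (hfpos y hy)]; exact hfK y hy
  have hi1 : 0 ≤ i + 1 := by linarith
  have j1 := aux_int hα0 hα1 hi1 hfc hfa
  have j0 := aux_int hα0 hα1 hi hfc hfa
  have jf : IntervalIntegrable f volume 0 1 := by
    refine ContinuousOn.intervalIntegrable ?_
    rwa [Set.uIcc_of_le zero_le_one]
  have y1 := aux_inty hα0 hα1 hi1
  have y0 := aux_inty hα0 hα1 hi
  set c := 2 * (i + 1) ^ (1 - α) - i ^ (1 - α) - (i + 1 + 1) ^ (1 - α) with hc
  set W : ℝ → ℝ := fun y => α * (1 - α) * ((i + 1 + y) ^ (-α - 1) + (i + y) ^ (-α - 1)) - c with hW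
  have hWanti : ∀ y z : ℝ, 0 < y → y ≤ z → W z ≤ W y := by
    intro y z hy hyz
    have e1 : (i + 1 + z) ^ (-α - 1) ≤ (i + 1 + y) ^ (-α - 1) :=
      Real.rpow_le_rpow_of_nonpos (by linarith) (by linarith) (by linarith)
    have e2 : (i + z) ^ (-α - 1) ≤ (i + y) ^ (-α - 1) :=
      Real.rpow_le_rpow_of_nonpos (by linarith) (by linarith) (by linarith)
    simp only [hW]
    gcongr
  have hdiv : ∀ y z : ℝ, 0 < y → y ≤ z → z ≤ 1 → f z / z ≤ f y / y := by
    intro y z hy hyz hz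
    have hz0 : 0 < z := by linarith
    have h := hf.2 (show (0:ℝ) ∈ Set.Icc (0:ℝ) 1 by simp) (show z ∈ Set.Icc (0:ℝ) 1 from ⟨hz0.le, hz⟩)
      (show 0 ≤ 1 - y / z by rw [sub_nonneg, div_le_one hz0]; exact hyz)
      (show 0 ≤ y / z by positivity) (by ring)
    simp only [smul_eq_mul, mul_zero, zero_add, hf0] at h
    rw [div_mul_cancel₀ _ hz0.ne'] at h
    rw [div_le_div_iff₀ hz0 hy]
    rw [div_mul_eq_mul_div, div_le_iff₀ hz0] at h
    linarith
  set S : Set ℝ := (fun y => f y / y) '' {y | 0 < y ∧ y ≤ 1 ∧ W y < 0} with hS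
  have hSb : BddAbove S := by
    refine ⟨K, ?_⟩
    rintro _ ⟨y, ⟨hy0, hy1, _⟩, rfl⟩
    show f y / y ≤ K
    rw [div_le_iff₀ hy0]
    exact hfK y ⟨hy0.le, hy1⟩
  set κ := sSup S with hκ
  have hκ0 : 0 ≤ κ := by
    refine Real.sSup_nonneg ?_
    rintro _ ⟨y, ⟨hy0, hy1, _⟩, rfl⟩
    exact div_nonneg (hfpos y ⟨hy0.le, hy1⟩) hy0.le
  have hpt : ∀ y ∈ Set.Icc (0:ℝ) 1, κ * (y * W y) ≤ f y * W y := by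
    rintro y ⟨h0, h1⟩
    rcases eq_or_lt_of_le h0 with h | h
    · subst h; simp [hf0]
    rw [← mul_assoc]
    rcases lt_or_ge (W y) 0 with hw | hw
    · have : f y / y ≤ κ := le_csSup hSb ⟨y, ⟨h, h1, hw⟩, rfl⟩
      rw [div_le_iff₀ h] at this
      exact mul_le_mul_of_nonpos_right this hw.le
    · have : κ ≤ f y / y := by
        refine Real.sSup_le ?_ (div_nonneg (hfpos y ⟨h0, h1⟩) h0)
        rintro _ ⟨z, ⟨hz0, hz1, hz⟩, rfl⟩
        refine hdiv y z h ?_ hz1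
        by_contra hc
        push Not at hc
        have := hWanti z y hz0 hc.le
        linarith
      rw [le_div_iff₀ h] at this
      exact mul_le_mul_of_nonneg_right this hw
  have dec : ∀ g : ℝ → ℝ, (fun y => g y * W y) = fun y =>
      α * (1 - α) * (g y * (i + 1 + y) ^ (-α - 1)) + α * (1 - α) * (g y * (i + y) ^ (-α - 1))
       - c * g y := by
    intro g; funext y; simp only [hW]; ring
  have I : ∀ g : ℝ → ℝ, IntervalIntegrable (fun y => g y * (i + 1 + y) ^ (-α - 1)) volume 0 1 →
      IntervalIntegrable (fun y => g y * (i + y) ^ (-α - 1)) volume 0 1 →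
      IntervalIntegrable g volume 0 1 →
      IntervalIntegrable (fun y => g y * W y) volume 0 1 ∧
      ∫ y in (0:ℝ)..1, g y * W y = α * (1 - α) * (∫ y in (0:ℝ)..1, g y * (i + 1 + y) ^ (-α - 1))
        + α * (1 - α) * (∫ y in (0:ℝ)..1, g y * (i + y) ^ (-α - 1)) - c * ∫ y in (0:ℝ)..1, g y := by
    intro g g1 g0 gg
    rw [dec g]
    refine ⟨((g1.const_mul _).add (g0.const_mul _)).sub (gg.const_mul _), ?_⟩
    rw [intervalIntegral.integral_sub ((g1.const_mul _).add (g0.const_mul _)) (gg.const_mul _),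
      intervalIntegral.integral_add (g1.const_mul _) (g0.const_mul _)]
    simp only [intervalIntegral.integral_const_mul]
  obtain ⟨If, ef⟩ := I f j1 j0 jf
  obtain ⟨Iy, ey⟩ := I (fun y => y) y1 y0 (by simp)
  have hmain := intervalIntegral.integral_mono_on zero_le_one (Iy.const_mul κ) If hpt
  rw [intervalIntegral.integral_const_mul, ef, ey] at hmain
  have hY : 0 ≤ α * (1 - α) * (∫ y in (0:ℝ)..1, y * (i + 1 + y) ^ (-α - 1))
        + α * (1 - α) * (∫ y in (0:ℝ)..1, y * (i + y) ^ (-α - 1)) - c * ∫ y in (0:ℝ)..1, y := by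
    have m0 := aux_moment0 hα0 hα1 (r := i + 1) (by linarith)
    have m1 := aux_Ymono hα0 hα1 hi
    have : ∫ y in (0:ℝ)..1, y = 1 / 2 := by simp
    rw [this, hc, aux_c hα0 hα1 hi]
    have := mul_nonneg (mul_pos hα0 h1α).le (show 0 ≤ (∫ y in (0:ℝ)..1, y * (i + y) ^ (-α - 1))
      + 3 * (∫ y in (0:ℝ)..1, y * (i + 1 + y) ^ (-α - 1))
      - (∫ y in (0:ℝ)..1, (i + 1 + y) ^ (-α - 1)) by linarith)
    linarith
  have := mul_nonneg hκ0 hY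
  linarith

lemma aux_conc {K s : ℝ} {h h' h'' : ℝ → ℝ} (hs : |s| ≤ 1)
    (hh : ∀ y ∈ Set.Icc (0:ℝ) 1, HasDerivAt h (h' y) y)
    (hh' : ∀ y ∈ Set.Icc (0:ℝ) 1, HasDerivAt h' (h'' y) y)
    (hK : ∀ y ∈ Set.Icc (0:ℝ) 1, |h'' y| ≤ K) :
    ConcaveOn ℝ (Set.Icc 0 1)
      (fun y => K * (y * (1 - y) / 2) - s * ((1 - y) * h 0 + y * h 1 - h y)) := by
  have d1 : ∀ y ∈ Set.Icc (0:ℝ) 1, HasDerivAt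
      (fun y => K * (y * (1 - y) / 2) - s * ((1 - y) * h 0 + y * h 1 - h y))
      (K * ((1 - 2 * y) / 2) - s * (h 1 - h 0 - h' y)) y := by
    intro y hy
    have h1 : HasDerivAt (fun y : ℝ => (1 - y) * h 0 + y * h 1) (-1 * h 0 + 1 * h 1) y :=
      (((hasDerivAt_id y).const_sub 1).mul_const _).add ((hasDerivAt_id y).mul_const _)
    have h2 : HasDerivAt (fun y : ℝ => y * (1 - y) / 2) ((1 * (1 - y) + y * (-1)) / 2) y :=
      ((hasDerivAt_id y).mul ((hasDerivAt_id y).const_sub 1)).div_const 2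
    refine HasDerivAt.congr_deriv ((h2.const_mul K).sub ((h1.sub (hh y hy)).const_mul s)) ?_
    ring
  have d2 : ∀ y ∈ Set.Icc (0:ℝ) 1, HasDerivAt
      (fun y => K * ((1 - 2 * y) / 2) - s * (h 1 - h 0 - h' y))
      (- K + s * h'' y) y := by
    intro y hy
    have h2 : HasDerivAt (fun y : ℝ => (1 - 2 * y) / 2) (-(2 * 1) / 2) y :=
      (((hasDerivAt_id y).const_mul 2).const_sub 1).div_const 2
    refine HasDerivAt.congr_deriv ((h2.const_mul K).sub (((hh' y hy).const_sub (h 1 - h 0)).const_mul s)) ?_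
    ring
  refine concaveOn_of_hasDerivWithinAt2_nonpos (convex_Icc 0 1)
    (f' := fun y => K * ((1 - 2 * y) / 2) - s * (h 1 - h 0 - h' y)) (f'' := fun y => - K + s * h'' y)
    (fun y hy => (d1 y hy).continuousAt.continuousWithinAt)
    (fun y hy => (d1 y (interior_subset hy)).hasDerivWithinAt)
    (fun y hy => (d2 y (interior_subset hy)).hasDerivWithinAt) ?_
  intro y hy
  have h1 := hK y (interior_subset hy)
  have h2 : |s * h'' y| ≤ 1 * K := by
    rw [abs_mul]
    exact mul_le_mul hs h1 (abs_nonneg _) zero_le_one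
  have := le_abs_self (s * h'' y)
  linarith

lemma aux_nonneg {K s : ℝ} {h h' h'' : ℝ → ℝ} (hs : |s| ≤ 1)
    (hh : ∀ y ∈ Set.Icc (0:ℝ) 1, HasDerivAt h (h' y) y)
    (hh' : ∀ y ∈ Set.Icc (0:ℝ) 1, HasDerivAt h' (h'' y) y)
    (hK : ∀ y ∈ Set.Icc (0:ℝ) 1, |h'' y| ≤ K) (y : ℝ) (hy : y ∈ Set.Icc (0:ℝ) 1) :
    0 ≤ K * (y * (1 - y) / 2) - s * ((1 - y) * h 0 + y * h 1 - h y) := by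
  have h1 := (aux_conc hs hh hh' hK).2 (show (0:ℝ) ∈ Set.Icc (0:ℝ) 1 by simp)
    (show (1:ℝ) ∈ Set.Icc (0:ℝ) 1 by simp)
    (show 0 ≤ 1 - y by linarith [hy.2]) hy.1 (by ring)
  simpa using h1

lemma aux_e {K : ℝ} {h h' h'' : ℝ → ℝ}
    (hh : ∀ y ∈ Set.Icc (0:ℝ) 1, HasDerivAt h (h' y) y)
    (hh' : ∀ y ∈ Set.Icc (0:ℝ) 1, HasDerivAt h' (h'' y) y)
    (hK : ∀ y ∈ Set.Icc (0:ℝ) 1, |h'' y| ≤ K) (y : ℝ) (hy : y ∈ Set.Icc (0:ℝ) 1) :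
    |(1 - y) * h 0 + y * h 1 - h y| ≤ K * (y * (1 - y) / 2) := by
  have h1 := aux_nonneg (s := 1) (by simp) hh hh' hK y hy
  have h2 := aux_nonneg (s := -1) (by simp) hh hh' hK y hy
  rw [abs_le]; constructor <;> linarith

lemma aux_e' {K : ℝ} {h h' h'' : ℝ → ℝ}
    (hh : ∀ y ∈ Set.Icc (0:ℝ) 1, HasDerivAt h (h' y) y)
    (hh' : ∀ y ∈ Set.Icc (0:ℝ) 1, HasDerivAt h' (h'' y) y)
    (hK : ∀ y ∈ Set.Icc (0:ℝ) 1, |h'' y| ≤ K) (y : ℝ) (hy : y ∈ Set.Icc (0:ℝ) 1) :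
    |(1 - y) * h 0 + y * h 1 - h y| ≤ K * y := by
  have h1 := aux_e hh hh' hK y hy
  have hK0 : 0 ≤ K := le_trans (abs_nonneg _) (hK y hy)
  refine h1.trans ?_
  have := hy.1
  have := hy.2
  gcongr
  nlinarith

/-- One-sided interval estimate. -/
lemma aux_one {α i K s : ℝ} (hα0 : 0 < α) (hα1 : α < 1) (hi : 0 ≤ i) {h h' h'' : ℝ → ℝ}
    (hs : |s| = 1)
    (hh : ∀ y ∈ Set.Icc (0:ℝ) 1, HasDerivAt h (h' y) y)
    (hh' : ∀ y ∈ Set.Icc (0:ℝ) 1, HasDerivAt h' (h'' y) y)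
    (hK : ∀ y ∈ Set.Icc (0:ℝ) 1, |h'' y| ≤ K) :
    s * (1 / 2 * (α * (1 - α) * ∫ y in (0:ℝ)..1, ((1 - y) * h 0 + y * h 1 - h y) * (i + 1 + y) ^ (-α - 1))
     + 1 / 2 * (α * (1 - α) * ∫ y in (0:ℝ)..1, ((1 - y) * h 0 + y * h 1 - h y) * (i + y) ^ (-α - 1))
     - (2 * (i + 1) ^ (1 - α) - i ^ (1 - α) - (i + 1 + 1) ^ (1 - α)) *
       ∫ y in (0:ℝ)..1, ((1 - y) * h 0 + y * h 1 - h y))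
     ≤ K * (1 / 2 * TT α (i + 1) + 1 / 2 * TT α i) := by
  have hi1 : 0 ≤ i + 1 := by linarith
  have hK0 : 0 ≤ K := le_trans (abs_nonneg _) (hK 0 (by simp))
  have hhc : ContinuousOn h (Set.Icc 0 1) := fun y hy => (hh y hy).continuousAt.continuousWithinAt
  set e : ℝ → ℝ := fun y => (1 - y) * h 0 + y * h 1 - h y with he
  have hec : ContinuousOn e (Set.Icc 0 1) := by simp only [he]; fun_prop
  have hea := aux_e hh hh' hK
  have hea' := aux_e' hh hh' hK
  have je1 := aux_int hα0 hα1 hi1 hec hea'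
  have je0 := aux_int hα0 hα1 hi hec hea'
  have jq1 := aux_intq hα0 hα1 hi1
  have jq0 := aux_intq hα0 hα1 hi
  have je : IntervalIntegrable e volume 0 1 := by
    refine ContinuousOn.intervalIntegrable ?_
    rwa [Set.uIcc_of_le zero_le_one]
  have jq : IntervalIntegrable (fun y : ℝ => y * (1 - y) / 2) volume 0 1 := by
    apply Continuous.intervalIntegrable; fun_prop
  have ch := aux_cheb (K := K) hα0 hα1 hi (aux_conc hs.le hh hh' hK) (by fun_prop) (by simp)
    (aux_nonneg hs.le hh hh' hK) ?_
  · have hc0 := aux_c_nonneg hα0 hα1 hi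
    set c := 2 * (i + 1) ^ (1 - α) - i ^ (1 - α) - (i + 1 + 1) ^ (1 - α) with hc
    have sp : ∀ r : ℝ, 0 ≤ r → 
        ∫ y in (0:ℝ)..1, (K * (y * (1 - y) / 2) - s * e y) * (r + y) ^ (-α - 1) =
        K * (∫ y in (0:ℝ)..1, (y * (1 - y) / 2) * (r + y) ^ (-α - 1)) -
        s * ∫ y in (0:ℝ)..1, e y * (r + y) ^ (-α - 1) := by
      intro r hr
      rw [← intervalIntegral.integral_const_mul, ← intervalIntegral.integral_const_mul,
        ← intervalIntegral.integral_sub ((aux_intq hα0 hα1 hr).const_mul _)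
          ((aux_int hα0 hα1 hr hec hea').const_mul _)]
      congr 1; funext y; ring
    have sp2 : ∫ y in (0:ℝ)..1, (K * (y * (1 - y) / 2) - s * e y) =
        K * (∫ y in (0:ℝ)..1, (y * (1 - y) / 2)) - s * ∫ y in (0:ℝ)..1, e y := by
      rw [intervalIntegral.integral_sub (jq.const_mul _) (je.const_mul _),
        intervalIntegral.integral_const_mul, intervalIntegral.integral_const_mul]
    have pos : 0 ≤ K * (∫ y in (0:ℝ)..1, (y * (1 - y) / 2)) + s * ∫ y in (0:ℝ)..1, e y := by
      rw [← intervalIntegral.integral_const_mul, ← intervalIntegral.integral_const_mul,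
        ← intervalIntegral.integral_add (jq.const_mul _) (je.const_mul _)]
      refine intervalIntegral.integral_nonneg zero_le_one ?_
      intro y hy
      have := aux_nonneg (s := -s) (by rw [abs_neg]; exact hs.le) hh hh' hK y hy
      simp only [he]
      linarith
    have ch' : c * (∫ y in (0:ℝ)..1, (K * (y * (1 - y) / 2) - s * e y)) ≤ α * (1 - α) *
      ((∫ y in (0:ℝ)..1, (K * (y * (1 - y) / 2) - s * e y) * (i + 1 + y) ^ (-α - 1)) +
       ∫ y in (0:ℝ)..1, (K * (y * (1 - y) / 2) - s * e y) * (i + y) ^ (-α - 1)) := ch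
    rw [sp _ hi1, sp _ hi, sp2] at ch'
    unfold TT
    have := mul_nonneg hc0 pos
    linarith
  · intro y hy
    have h1 := hea y hy
    have h2 : |s * ((1 - y) * h 0 + y * h 1 - h y)| ≤ K * (y * (1 - y) / 2) := by
      rw [abs_mul, hs, one_mul]; exact h1
    have h3 := neg_abs_le (s * ((1 - y) * h 0 + y * h 1 - h y))
    have : K * (y * (1 - y)) ≤ K * y := by
      have := hy.1
      gcongr; nlinarith
    linarith

lemma aux_two {α i K : ℝ} (hα0 : 0 < α) (hα1 : α < 1) (hi : 0 ≤ i) {h h' h'' : ℝ → ℝ}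
    (hh : ∀ y ∈ Set.Icc (0:ℝ) 1, HasDerivAt h (h' y) y)
    (hh' : ∀ y ∈ Set.Icc (0:ℝ) 1, HasDerivAt h' (h'' y) y)
    (hK : ∀ y ∈ Set.Icc (0:ℝ) 1, |h'' y| ≤ K) :
    |1 / 2 * (α * (1 - α) * ∫ y in (0:ℝ)..1, ((1 - y) * h 0 + y * h 1 - h y) * (i + 1 + y) ^ (-α - 1))
     + 1 / 2 * (α * (1 - α) * ∫ y in (0:ℝ)..1, ((1 - y) * h 0 + y * h 1 - h y) * (i + y) ^ (-α - 1))
     - (2 * (i + 1) ^ (1 - α) - i ^ (1 - α) - (i + 1 + 1) ^ (1 - α)) *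
       ∫ y in (0:ℝ)..1, ((1 - y) * h 0 + y * h 1 - h y)|
     ≤ K * (1 / 2 * TT α (i + 1) + 1 / 2 * TT α i) := by
  have h1 := aux_one (s := 1) hα0 hα1 hi (by simp) hh hh' hK
  have h2 := aux_one (s := -1) hα0 hα1 hi (by simp) hh hh' hK
  rw [abs_le]; constructor <;> linarith

lemma aux_zero {α K : ℝ} (hα0 : 0 < α) (hα1 : α < 1) {h h' h'' : ℝ → ℝ}
    (hh : ∀ y ∈ Set.Icc (0:ℝ) 1, HasDerivAt h (h' y) y)
    (hh' : ∀ y ∈ Set.Icc (0:ℝ) 1, HasDerivAt h' (h'' y) y)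
    (hK : ∀ y ∈ Set.Icc (0:ℝ) 1, |h'' y| ≤ K) :
    |1 / 2 * (α * (1 - α) * ∫ y in (0:ℝ)..1, ((1 - y) * h 0 + y * h 1 - h y) * (0 + y) ^ (-α - 1))
     + ∫ y in (0:ℝ)..1, ((1 - y) * h 0 + y * h 1 - h y)|
     ≤ K * (1 / 2 * TT α 0 + 1 / 12) := by
  have h1α : 0 < 1 - α := by linarith
  have hea := aux_e hh hh' hK
  have q1 : |∫ y in (0:ℝ)..1, ((1 - y) * h 0 + y * h 1 - h y) * (0 + y) ^ (-α - 1)| ≤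
      K * ∫ y in (0:ℝ)..1, (y * (1 - y) / 2) * (0 + y) ^ (-α - 1) := by
    rw [← intervalIntegral.integral_const_mul]
    rw [← Real.norm_eq_abs]
    refine intervalIntegral.norm_integral_le_of_norm_le zero_le_one ?_
      ((aux_intq hα0 hα1 le_rfl).const_mul _)
    refine Filter.Eventually.of_forall ?_
    intro y hy
    have hy0 := hy.1
    have hp : 0 ≤ (0 + y) ^ (-α - 1) := by positivity
    rw [Real.norm_eq_abs, abs_mul, abs_of_nonneg hp, ← mul_assoc]
    exact mul_le_mul_of_nonneg_right (hea y ⟨hy.1.le, hy.2⟩) hp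
  have q2 : |∫ y in (0:ℝ)..1, ((1 - y) * h 0 + y * h 1 - h y)| ≤
      K * ∫ y in (0:ℝ)..1, (y * (1 - y) / 2) := by
    rw [← intervalIntegral.integral_const_mul]
    rw [← Real.norm_eq_abs]
    refine intervalIntegral.norm_integral_le_of_norm_le zero_le_one ?_
      (by apply Continuous.intervalIntegrable; fun_prop)
    refine Filter.Eventually.of_forall ?_
    intro y hy
    exact hea y ⟨hy.1.le, hy.2⟩
  have q3 : ∫ y in (0:ℝ)..1, (y * (1 - y) / 2) = 1 / 12 := by
    have : ∀ y : ℝ, y * (1 - y) / 2 = (y - y ^ 2) / 2 := fun y => by ring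
    simp only [this]
    rw [intervalIntegral.integral_div, intervalIntegral.integral_sub (by simp) (by simp)]
    simp
    norm_num
  rw [q3] at q2
  refine (abs_add_le _ _).trans ?_
  rw [abs_mul, abs_mul, abs_of_pos (show (0:ℝ) < 1 / 2 by norm_num),
    abs_of_pos (show 0 < α * (1 - α) by positivity)]
  unfold TT
  have := mul_le_mul_of_nonneg_left q1 (show 0 ≤ α * (1 - α) by positivity)
  linarith

lemma aux_split {α : ℝ} (hα1 : α < 1) (m : ℕ) {g : ℝ → ℝ}
    (hg : ContinuousOn g (Set.Icc 0 (m:ℝ))) :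
    ∫ x in (0:ℝ)..(m:ℝ), x ^ (-α) * g x =
      ∑ j ∈ range m, ∫ y in (0:ℝ)..1, ((j:ℝ) + y) ^ (-α) * g ((j:ℝ) + y) := by
  have h := intervalIntegral.sum_integral_adjacent_intervals (μ := volume)
    (f := fun x : ℝ => x ^ (-α) * g x) (a := fun k : ℕ => (k:ℝ)) (n := m) ?_
  · simp only [Nat.cast_zero] at h
    rw [← h]
    refine sum_congr rfl ?_
    intro j _
    rw [intervalIntegral.integral_comp_add_left (fun x : ℝ => x ^ (-α) * g x) (j:ℝ)]
    simp
  · intro k hk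
    refine (intervalIntegral.intervalIntegrable_rpow' (by linarith)).mul_continuousOn (hg.mono ?_)
    rw [Set.uIcc_of_le (by simp)]
    refine Set.Icc_subset_Icc (by positivity) ?_
    exact_mod_cast hk

lemma aux_alg (a g D E X Y : ℕ → ℝ) (m : ℕ)
    (hD : ∀ j, j < m + 1 → D j = (g j + g (j + 1)) / 2 - E j) :
    1 / 2 * ((∑ j ∈ range (m + 1), (a j * (g j - g (j + 1)) + X j))
      + ∑ j ∈ range m, (a j * (g (j + 1) - g (j + 1 + 1)) + Y j))
     - (a 0 * D 0 - (∑ j ∈ range m, (a j - a (j + 1)) * D (j + 1)) - a m * g (m + 1))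
     = (1 / 2 * X 0 + a 0 * E 0)
      + ∑ j ∈ range m, (1 / 2 * X (j + 1) + 1 / 2 * Y j - (a j - a (j + 1)) * E (j + 1)) := by
  induction m with
  | zero =>
    simp [hD 0 (by norm_num)]
    ring
  | succ k ih =>
    have h1 := ih (fun j hj => hD j (by omega))
    have h2 := hD (k + 1) (by omega)
    rw [sum_range_succ _ (k + 1), sum_range_succ _ k, sum_range_succ _ k, sum_range_succ _ k]
    rw [h2]
    rw [sum_range_succ _ k] at h1
    rw [sum_range_succ _ k]
    linear_combination h1

lemma aux_core {α K : ℝ} (hα0 : 0 < α) (hα1 : α < 1) (m : ℕ) {G G' G'' : ℝ → ℝ}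
    (hG : ∀ x ∈ Set.Icc (0:ℝ) ((m:ℝ) + 1), HasDerivAt G (G' x) x)
    (hG' : ∀ x ∈ Set.Icc (0:ℝ) ((m:ℝ) + 1), HasDerivAt G' (G'' x) x)
    (hK : ∀ x ∈ Set.Icc (0:ℝ) ((m:ℝ) + 1), |G'' x| ≤ K)
    (a : ℕ → ℝ) (ha : ∀ k : ℕ, a k = ((k : ℝ) + 1) ^ (1 - α) - (k : ℝ) ^ (1 - α)) :
    |1 / 2 * ((-(1 - α) * ∫ x in (0:ℝ)..((m:ℝ) + 1), x ^ (-α) * G' x)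
        + (-(1 - α) * ∫ x in (0:ℝ)..(m:ℝ), x ^ (-α) * G' (x + 1)))
      - (a 0 * (∫ y in (0:ℝ)..1, G (((0:ℕ):ℝ) + y))
        - (∑ j ∈ range m, (a j - a (j + 1)) * ∫ y in (0:ℝ)..1, G (((j + 1 : ℕ) : ℝ) + y))
        - a m * G ((m:ℝ) + 1))| ≤
      K * (((1 - α) / 12 + (2:ℝ) ^ (2 - α) / (2 - α) - (1 + (2:ℝ) ^ (-α))) + 1 / 12) := by
  have hK0 : 0 ≤ K := le_trans (abs_nonneg _) (hK 0 ⟨le_rfl, by positivity⟩)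
  have mem : ∀ j : ℕ, j < m + 1 → ∀ y ∈ Set.Icc (0:ℝ) 1, (j:ℝ) + y ∈ Set.Icc (0:ℝ) ((m:ℝ) + 1) := by
    intro j hj y hy
    have h1 : (j:ℝ) ≤ m := by exact_mod_cast Nat.lt_succ_iff.1 hj
    exact ⟨add_nonneg (by positivity) hy.1, by linarith [hy.2]⟩
  have d1 : ∀ j : ℕ, j < m + 1 → ∀ y ∈ Set.Icc (0:ℝ) 1,
      HasDerivAt (fun y => G ((j:ℝ) + y)) (G' ((j:ℝ) + y)) y := fun j hj y hy =>
    (hG _ (mem j hj y hy)).comp_const_add _ _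
  have d2 : ∀ j : ℕ, j < m + 1 → ∀ y ∈ Set.Icc (0:ℝ) 1,
      HasDerivAt (fun y => G' ((j:ℝ) + y)) (G'' ((j:ℝ) + y)) y := fun j hj y hy =>
    (hG' _ (mem j hj y hy)).comp_const_add _ _
  have d3 : ∀ j : ℕ, j < m + 1 → ∀ y ∈ Set.Icc (0:ℝ) 1, |G'' ((j:ℝ) + y)| ≤ K := fun j hj y hy =>
    hK _ (mem j hj y hy)
  have hGc : ContinuousOn G' (Set.Icc (0:ℝ) ((m:ℝ) + 1)) :=
    fun x hx => (hG' x hx).continuousAt.continuousWithinAt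
  set e : ℕ → ℝ → ℝ := fun j y => (1 - y) * G ((j:ℝ) + 0) + y * G ((j:ℝ) + 1) - G ((j:ℝ) + y) with he
  have L1 : ∀ j : ℕ, j < m + 1 → ∀ r : ℝ, 0 ≤ r →
      -(1 - α) * ∫ y in (0:ℝ)..1, (r + y) ^ (-α) * G' ((j:ℝ) + y) =
      ((r + 1) ^ (1 - α) - r ^ (1 - α)) * (G ((j:ℝ) + 0) - G ((j:ℝ) + 1)) +
      α * (1 - α) * ∫ y in (0:ℝ)..1, e j y * (r + y) ^ (-α - 1) := by
    intro j hj r hr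
    exact aux_L1 (C := K) hα0 hα1 hr (d1 j hj)
      (fun y hy => (d2 j hj y hy).continuousAt.continuousWithinAt)
      (aux_e' (d1 j hj) (d2 j hj) (d3 j hj))
  have s1 : -(1 - α) * ∫ x in (0:ℝ)..((m:ℝ) + 1), x ^ (-α) * G' x =
      ∑ j ∈ range (m + 1), (a j * (G ((j:ℕ):ℝ) - G ((j + 1 : ℕ):ℝ)) +
        α * (1 - α) * ∫ y in (0:ℝ)..1, e j y * ((j:ℝ) + y) ^ (-α - 1)) := by
    have h := aux_split (α := α) hα1 (m + 1) (g := G') (by push_cast; exact hGc)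
    push_cast at h
    rw [h, mul_sum]
    refine sum_congr rfl ?_
    intro j hj
    rw [L1 j (mem_range.1 hj) j (by positivity), ha j]
    push_cast
    rw [add_zero]
  have s2 : -(1 - α) * ∫ x in (0:ℝ)..(m:ℝ), x ^ (-α) * G' (x + 1) =
      ∑ j ∈ range m, (a j * (G ((j + 1 : ℕ):ℝ) - G ((j + 1 + 1 : ℕ):ℝ)) +
        α * (1 - α) * ∫ y in (0:ℝ)..1, e (j + 1) y * ((j:ℝ) + y) ^ (-α - 1)) := by
    have h := aux_split (α := α) hα1 m (g := fun x => G' (x + 1)) ?_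
    · rw [h, mul_sum]
      refine sum_congr rfl ?_
      intro j hj
      have hj' := mem_range.1 hj
      have h3 := L1 (j + 1) (by omega) j (by positivity)
      push_cast at h3 ⊢
      rw [ha j]
      simp only [add_zero] at h3
      rw [← h3]
      congr 2
      funext y
      congr 2
      ring
    · refine hGc.comp (by fun_prop) ?_
      intro x hx
      exact ⟨by linarith [hx.1], by linarith [hx.2]⟩
  have hD : ∀ j, j < m + 1 → (fun j : ℕ => ∫ y in (0:ℝ)..1, G ((j:ℝ) + y)) j =
      ((fun j : ℕ => G (j:ℝ)) j + (fun j : ℕ => G (j:ℝ)) (j + 1)) / 2 -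
        (fun j : ℕ => ∫ y in (0:ℝ)..1, e j y) j := by
    intro j hj
    simp only [he]
    have i1 : IntervalIntegrable (fun y => G ((j:ℝ) + y)) volume 0 1 := by
      refine ContinuousOn.intervalIntegrable ?_
      rw [Set.uIcc_of_le zero_le_one]
      exact fun y hy => (d1 j hj y hy).continuousAt.continuousWithinAt
    rw [intervalIntegral.integral_sub (by apply Continuous.intervalIntegrable; fun_prop) i1,
      intervalIntegral.integral_add (by apply Continuous.intervalIntegrable; fun_prop)
        (by apply Continuous.intervalIntegrable; fun_prop),
      intervalIntegral.integral_mul_const, intervalIntegral.integral_mul_const,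
      intervalIntegral.integral_sub (by simp) (by simp)]
    simp
    ring
  have alg := aux_alg a (fun j : ℕ => G (j:ℝ)) (fun j : ℕ => ∫ y in (0:ℝ)..1, G ((j:ℝ) + y))
    (fun j : ℕ => ∫ y in (0:ℝ)..1, e j y)
    (fun j => α * (1 - α) * ∫ y in (0:ℝ)..1, e j y * ((j:ℝ) + y) ^ (-α - 1))
    (fun j => α * (1 - α) * ∫ y in (0:ℝ)..1, e (j + 1) y * ((j:ℝ) + y) ^ (-α - 1)) m hD
  rw [s1, s2]
  have hm1 : G ((m:ℝ) + 1) = G ((m + 1 : ℕ) : ℝ) := by push_cast; rfl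
  rw [hm1]
  refine (le_of_eq (congrArg abs alg)).trans ?_
  have b0 := aux_zero hα0 hα1 (d1 0 (by omega)) (d2 0 (by omega)) (d3 0 (by omega))
  have a0 : a 0 = 1 := by
    rw [ha 0]; simp [Real.zero_rpow (show 1 - α ≠ 0 by linarith)]
  have b1 : ∀ j ∈ range m, |1 / 2 * (α * (1 - α) * ∫ y in (0:ℝ)..1, e (j + 1) y * (((j + 1 : ℕ):ℝ) + y) ^ (-α - 1))
      + 1 / 2 * (α * (1 - α) * ∫ y in (0:ℝ)..1, e (j + 1) y * ((j:ℝ) + y) ^ (-α - 1))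
      - (a j - a (j + 1)) * ∫ y in (0:ℝ)..1, e (j + 1) y| ≤
      K * (1 / 2 * TT α (((j + 1 : ℕ) : ℝ)) + 1 / 2 * TT α j) := by
    intro j hj
    have hj' : j + 1 < m + 1 := by have := mem_range.1 hj; omega
    have h := aux_two (i := (j:ℝ)) hα0 hα1 (by positivity) (d1 (j + 1) hj') (d2 (j + 1) hj') (d3 (j + 1) hj')
    have hcj : a j - a (j + 1) = 2 * ((j:ℝ) + 1) ^ (1 - α) - (j:ℝ) ^ (1 - α) - ((j:ℝ) + 1 + 1) ^ (1 - α) := by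
      rw [ha, ha]; push_cast; ring
    rw [hcj]
    have hcast : ((j + 1 : ℕ) : ℝ) = (j:ℝ) + 1 := by push_cast; rfl
    rw [← hcast] at h ⊢
    exact h
  have b2 := (abs_sum_le_sum_abs (fun j : ℕ => 1 / 2 * (α * (1 - α) * ∫ y in (0:ℝ)..1, e (j + 1) y * (((j + 1 : ℕ):ℝ) + y) ^ (-α - 1))
      + 1 / 2 * (α * (1 - α) * ∫ y in (0:ℝ)..1, e (j + 1) y * ((j:ℝ) + y) ^ (-α - 1))
      - (a j - a (j + 1)) * ∫ y in (0:ℝ)..1, e (j + 1) y) (range m)).trans (sum_le_sum b1)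
  have b0' : |1 / 2 * (α * (1 - α) * ∫ y in (0:ℝ)..1, e 0 y * (((0:ℕ):ℝ) + y) ^ (-α - 1))
     + a 0 * ∫ y in (0:ℝ)..1, e 0 y| ≤ K * (1 / 2 * TT α 0 + 1 / 12) := by
    rw [a0, one_mul]
    simp only [Nat.cast_zero] at b0 ⊢
    simpa [he] using b0
  refine (abs_add_le _ _).trans ((add_le_add b0' b2).trans ?_)
  rw [← mul_sum, ← mul_add]
  refine mul_le_mul_of_nonneg_left ?_ hK0
  rw [sum_add_distrib, ← mul_sum, ← mul_sum]
  have t1 := TT_sum hα0 hα1 m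
  have t2 := TT_sum hα0 hα1 (m + 1)
  rw [sum_range_succ'] at t2
  simp only [Nat.cast_zero] at t2
  linarith

lemma aux_caputo {β τ : ℝ} (hβ2 : β < 2) (hτ : 0 < τ) (m : ℝ) (hm : 0 ≤ m)
    (w : ℝ → ℝ) :
    caputoDeriv β w (m * τ) = (τ ^ (1 - β) / Real.Gamma (3 - β)) *
      (-(1 - (β - 1)) * ∫ x in (0:ℝ)..m, x ^ (-(β - 1)) * (-τ * w (m * τ - τ * x))) := by
  unfold caputoDeriv
  have h := intervalIntegral.integral_comp_sub_mul (a := 0) (b := m)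
    (fun ξ => (m * τ - ξ) ^ (1 - β) * w ξ) hτ.ne' (m * τ)
  rw [show m * τ - τ * m = 0 by ring, show m * τ - τ * 0 = m * τ by ring] at h
  have h2 : ∫ x in (0:ℝ)..m, (m * τ - (m * τ - τ * x)) ^ (1 - β) * w (m * τ - τ * x) =
     ∫ x in (0:ℝ)..m, (-τ ^ (1 - β) * τ⁻¹) * (x ^ (-(β - 1)) * (-τ * w (m * τ - τ * x))) := by
    refine intervalIntegral.integral_congr ?_
    intro x hx
    rw [Set.uIcc_of_le hm] at hx
    show (m * τ - (m * τ - τ * x)) ^ (1 - β) * w (m * τ - τ * x) =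
      (-τ ^ (1 - β) * τ⁻¹) * (x ^ (-(β - 1)) * (-τ * w (m * τ - τ * x)))
    rw [show m * τ - (m * τ - τ * x) = τ * x by ring, Real.mul_rpow hτ.le hx.1,
      show -(β - 1) = 1 - β by ring]
    field_simp
  rw [h2, intervalIntegral.integral_const_mul, smul_eq_mul] at h
  have hg : Real.Gamma (3 - β) = (2 - β) * Real.Gamma (2 - β) := by
    rw [← Real.Gamma_add_one (by linarith)]; congr 1; ring
  have hg0 : Real.Gamma (2 - β) ≠ 0 := (Real.Gamma_pos_of_pos (by linarith)).ne'
  have hb : 2 - β ≠ 0 := by linarith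
  have h3 : ∫ ξ in (0:ℝ)..m * τ, (m * τ - ξ) ^ (1 - β) * w ξ = -τ ^ (1 - β) *
      ∫ x in (0:ℝ)..m, x ^ (-(β - 1)) * (-τ * w (m * τ - τ * x)) := by
    have : τ⁻¹ ≠ 0 := by positivity
    apply mul_left_cancel₀ this
    rw [← h]; ring
  rw [h3, hg]
  generalize (∫ x in (0:ℝ)..m, x ^ (-(β - 1)) * (-τ * w (m * τ - τ * x))) = J
  field_simp
  ring

theorem stmt_11 (β τ : ℝ) (hβ1 : 1 < β) (hβ2 : β < 2) (hτ : 0 < τ)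
    (n : ℕ) (hn : 1 ≤ n)
    (v v' v'' v''' : ℝ → ℝ)
    (hv' : ∀ t ∈ Set.Icc (0:ℝ) ((n : ℝ) * τ), HasDerivAt v (v' t) t)
    (hv'' : ∀ t ∈ Set.Icc (0:ℝ) ((n : ℝ) * τ), HasDerivAt v' (v'' t) t)
    (hv''' : ∀ t ∈ Set.Icc (0:ℝ) ((n : ℝ) * τ), HasDerivAt v'' (v''' t) t)
    (hcont : ContinuousOn v''' (Set.Icc (0:ℝ) ((n : ℝ) * τ)))
    (a : ℕ → ℝ) (ha : ∀ k : ℕ, a k = ((k : ℝ) + 1) ^ (2 - β) - (k : ℝ) ^ (2 - β))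
    (δ : ℕ → ℝ) (hδ : ∀ k : ℕ, δ k = (v ((k : ℝ) * τ) - v (((k : ℝ) - 1) * τ)) / τ) :
    |(1 / 2) * (caputoDeriv β v'' ((n : ℝ) * τ) + caputoDeriv β v'' (((n : ℝ) - 1) * τ))
        - (τ ^ (1 - β) / Real.Gamma (3 - β)) *
          (a 0 * δ n
            - (∑ k ∈ Finset.Icc 1 (n - 1), (a (n - k - 1) - a (n - k)) * δ k)
            - a (n - 1) * v' 0)|
      ≤ (1 / Real.Gamma (3 - β)) *
          ((2 - β) / 12 + (2:ℝ) ^ (3 - β) / (3 - β) - (1 + (2:ℝ) ^ (1 - β)) + 1 / 12) *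
          sSup ((fun t => |v''' t|) '' Set.Icc (0:ℝ) ((n : ℝ) * τ)) * τ ^ (3 - β) := by
  obtain ⟨m, rfl⟩ : ∃ m, n = m + 1 := ⟨n - 1, by omega⟩
  push_cast at *
  set M := sSup ((fun t => |v''' t|) '' Set.Icc (0:ℝ) (((m : ℝ) + 1) * τ)) with hM
  have hMb : ∀ t ∈ Set.Icc (0:ℝ) (((m : ℝ) + 1) * τ), |v''' t| ≤ M := by
    intro t ht
    refine le_csSup ?_ ⟨t, ht, rfl⟩
    exact (isCompact_Icc.image_of_continuousOn hcont.abs).bddAbove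
  have mem : ∀ x ∈ Set.Icc (0:ℝ) ((m:ℝ) + 1),
      ((m:ℝ) + 1) * τ - τ * x ∈ Set.Icc (0:ℝ) (((m : ℝ) + 1) * τ) := by
    intro x hx
    exact ⟨by nlinarith [hx.2], by nlinarith [hx.1]⟩
  have din : ∀ x : ℝ, HasDerivAt (fun x : ℝ => ((m:ℝ) + 1) * τ - τ * x) (-(τ * 1)) x :=
    fun x => ((hasDerivAt_id x).const_mul τ).const_sub _
  have core := aux_core (α := β - 1) (K := τ ^ 2 * M) (by linarith) (by linarith) m
    (G := fun x => v' (((m:ℝ) + 1) * τ - τ * x))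
    (G' := fun x => -τ * v'' (((m:ℝ) + 1) * τ - τ * x))
    (G'' := fun x => τ ^ 2 * v''' (((m:ℝ) + 1) * τ - τ * x)) ?_ ?_ ?_ a ?_
  · have D : ∀ j : ℕ, j < m + 1 → ∫ y in (0:ℝ)..1, v' (((m:ℝ) + 1) * τ - τ * ((j:ℝ) + y)) =
        δ (m + 1 - j) := by
      intro j hj
      have hjm : (j:ℝ) ≤ m := by exact_mod_cast Nat.lt_succ_iff.1 hj
      have mem2 : ∀ y ∈ Set.Icc (0:ℝ) 1,
          ((m:ℝ) + 1) * τ - τ * ((j:ℝ) + y) ∈ Set.Icc (0:ℝ) (((m : ℝ) + 1) * τ) := by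
        intro y hy
        refine mem _ ⟨add_nonneg (by positivity) hy.1, by linarith [hy.2]⟩
      have din2 : ∀ y : ℝ, HasDerivAt (fun y : ℝ => ((m:ℝ) + 1) * τ - τ * ((j:ℝ) + y)) (-(τ * 1)) y :=
        fun y => (((hasDerivAt_id y).const_add (j:ℝ)).const_mul τ).const_sub _
      have ftc : ∫ y in (0:ℝ)..1, v' (((m:ℝ) + 1) * τ - τ * ((j:ℝ) + y)) =
          -(v (((m:ℝ) + 1) * τ - τ * ((j:ℝ) + 1)) / τ) - -(v (((m:ℝ) + 1) * τ - τ * ((j:ℝ) + 0)) / τ) := by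
        refine intervalIntegral.integral_eq_sub_of_hasDerivAt
          (f := fun y => -(v (((m:ℝ) + 1) * τ - τ * ((j:ℝ) + y)) / τ)) ?_ ?_
        · intro y hy
          rw [Set.uIcc_of_le zero_le_one] at hy
          refine HasDerivAt.congr_deriv ((((hv' _ (mem2 y hy)).comp y (din2 y)).div_const τ).neg) ?_
          field_simp
        · refine ContinuousOn.intervalIntegrable ?_
          rw [Set.uIcc_of_le zero_le_one]
          intro y hy
          exact ((hv'' _ (mem2 y hy)).comp y (din2 y)).continuousAt.continuousWithinAt
      rw [ftc, hδ, Nat.cast_sub hj.le]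
      push_cast
      rw [show ((m:ℝ) + 1) * τ - τ * ((j:ℝ) + 1) = ((m:ℝ) + 1 - j - 1) * τ by ring,
        show ((m:ℝ) + 1) * τ - τ * ((j:ℝ) + 0) = ((m:ℝ) + 1 - j) * τ by ring]
      ring
    have hsum : ∑ k ∈ Finset.Icc 1 m, (a (m + 1 - k - 1) - a (m + 1 - k)) * δ k =
        ∑ j ∈ range m, (a j - a (j + 1)) *
          ∫ y in (0:ℝ)..1, v' (((m:ℝ) + 1) * τ - τ * (((j + 1 : ℕ):ℝ) + y)) := by
      refine Finset.sum_nbij' (fun k => m - k) (fun j => m - j) ?_ ?_ ?_ ?_ ?_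
      · intro k hk; simp only [Finset.mem_Icc, Finset.mem_range] at *; omega
      · intro k hk; simp only [Finset.mem_Icc, Finset.mem_range] at *; omega
      · intro k hk; simp only [Finset.mem_Icc] at *; omega
      · intro k hk; simp only [Finset.mem_range] at *; omega
      · intro k hk
        simp only [Finset.mem_Icc] at hk
        rw [D (m - k + 1) (by omega)]
        rw [show m + 1 - k - 1 = m - k by omega, show m + 1 - k = m - k + 1 by omega,
          show m + 1 - (m - k + 1) = k by omega]
    have c1 := aux_caputo hβ2 hτ ((m:ℝ) + 1) (by positivity) v''
    have c2 := aux_caputo hβ2 hτ (m:ℝ) (by positivity) v''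
    have D0 := D 0 (by omega)
    rw [hsum]
    rw [D0, show m + 1 - 0 = m + 1 by omega] at core
    rw [show (m:ℝ) + 1 - 1 = m by ring, c1, c2]
    simp only [show ∀ x : ℝ, ((m:ℝ) + 1) * τ - τ * (x + 1) = (m:ℝ) * τ - τ * x by intro x; ring] at core
    rw [show (m:ℝ) * τ - τ * m = 0 by ring] at core
    have hP : 0 < τ ^ (1 - β) / Real.Gamma (3 - β) := by
      have := Real.Gamma_pos_of_pos (show 0 < 3 - β by linarith)
      positivity
    have fin := mul_le_mul_of_nonneg_left core hP.le
    rw [← abs_of_pos hP, ← abs_mul, abs_of_pos hP] at fin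
    have hpow : τ ^ (3 - β) = τ ^ (1 - β) * τ ^ 2 := by
      rw [← Real.rpow_natCast, ← Real.rpow_add hτ]; congr 1; push_cast; ring
    refine le_trans (le_of_eq ?_) (fin.trans (le_of_eq ?_))
    · congr 1
      ring
    · rw [hpow, show 1 - (β - 1) = 2 - β by ring, show 2 - (β - 1) = 3 - β by ring,
        show -(β - 1) = 1 - β by ring]
      ring
  · intro x hx
    refine HasDerivAt.congr_deriv ((hv'' _ (mem x hx)).comp x (din x)) ?_
    ring
  · intro x hx
    refine HasDerivAt.congr_deriv (((hv''' _ (mem x hx)).comp x (din x)).const_mul (-τ)) ?_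
    ring
  · intro x hx
    rw [abs_mul, abs_of_pos (by positivity)]
    exact mul_le_mul_of_nonneg_left (hMb _ (mem x hx)) (by positivity)
  · intro k
    rw [ha k, show 1 - (β - 1) = 2 - β by ring]
end

section
/- Let $K\ge1$ be an integer, let $\Delta\beta>0$, let $\beta_1,\dots,\beta_K\in(1,2)$ and $p_1,\dots,p_K>0$, let $\tau>0$, $t_m=m\tau$, and set $b_k^{(\beta_l)}=\frac{\tau^{2-\beta_l}}{2-\beta_l}\big[(k+1)^{2-\beta_l}-k^{2-\beta_l}\big]$ and $K_m=\Delta\beta\sum_{l=1}^{K}p_l\frac{t_m^{1-\beta_l}}{\Gamma(2-\beta_l)}>0$. Let $\varepsilon^0,\dots,\varepsilon^m$ and $\psi^{*}$ be grid functions, and write $\delta_t\varepsilon^{n-1/2}_{ij}=(\varepsilon^n_{ij}-\varepsilon^{n-1}_{ij})/\tau$. Then $\Delta\beta\sum_{l=1}^{K}p_l\frac{1}{\Gamma(2-\beta_l)}\,h_1h_2\sum_{i=1}^{M_1-1}\sum_{j=1}^{M_2-1}\sum_{n=1}^{m}\Big[b_0^{(\beta_l)}\delta_t\varepsilon^{n-1/2}_{ij}-\sum_{k=1}^{n-1}\big(b_{n-k-1}^{(\beta_l)}-b_{n-k}^{(\beta_l)}\big)\delta_t\varepsilon^{k-1/2}_{ij}-b_{n-1}^{(\beta_l)}\psi^{*}_{ij}\Big]\delta_t\varepsilon^{n-1/2}_{ij}\;\ge\;\frac{\tau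 K_m}{2}\sum_{n=1}^{m}\big\|\delta_t\varepsilon^{n-1/2}\big\|^2-\Delta\beta\sum_{l=1}^{K}p_l\frac{t_m^{2-\beta_l}}{2\,\Gamma(3-\beta_l)}\,\|\psi^{*}\|^2$. -/
open Finset

/-- Squared discrete L² norm of a grid function. -/
noncomputable def gridNormSq (h₁ h₂ : ℝ) (M₁ M₂ : ℕ) (v : ℕ → ℕ → ℝ) : ℝ :=
  h₁ * h₂ * ∑ i ∈ Finset.Icc 1 (M₁ - 1), ∑ j ∈ Finset.Icc 1 (M₂ - 1), (v i j) ^ 2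

theorem aux_young (n : ℕ) (c x : ℕ → ℝ) (hc : ∀ k, c (k + 1) ≤ c k) (hc0 : ∀ k, 0 ≤ c k) (y ψ : ℝ) :
    (c 0 * y - (∑ k ∈ Finset.Icc 1 n, (c (n + 1 - k - 1) - c (n + 1 - k)) * x k) - c n * ψ) * y
      ≥ c 0 * y ^ 2 / 2 - (∑ k ∈ Finset.Icc 1 n, (c (n - k) - c (n + 1 - k)) * x k ^ 2) / 2
        - c n * ψ ^ 2 / 2 := by
  have htel : ∑ k ∈ Finset.Icc 1 n, (c (n - k) - c (n + 1 - k)) = c 0 - c n := by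
    clear hc hc0
    induction n with
    | zero => simp
    | succ n ih =>
      have h2 : ∀ N : ℕ, ∑ k ∈ Finset.Icc 1 N, (c (N - k) - c (N + 1 - k))
          = ∑ k ∈ Finset.range N, (c k - c (k + 1)) := by
        intro N
        apply Finset.sum_bij' (fun k _ => N - k) (fun k _ => N - k)
        · intro k hk; simp at hk ⊢; omega
        · intro k hk; simp at hk ⊢; omega
        · intro k hk; simp at hk ⊢; omega
        · intro k hk; simp at hk ⊢; omega
        · intro k hk
          simp at hk
          rw [show N + 1 - k = N - k + 1 by omega]
      rw [h2, Finset.sum_range_sub']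
  have hle : (∑ k ∈ Finset.Icc 1 n, (c (n + 1 - k - 1) - c (n + 1 - k)) * x k) * y
      ≤ (∑ k ∈ Finset.Icc 1 n, (c (n - k) - c (n + 1 - k)) * x k ^ 2) / 2
        + (c 0 - c n) * y ^ 2 / 2 := by
    rw [← htel, Finset.sum_mul, Finset.sum_mul, Finset.sum_div, Finset.sum_div,
      ← Finset.sum_add_distrib]
    apply Finset.sum_le_sum
    intro k hk
    simp at hk
    rw [show n + 1 - k - 1 = n - k by omega, show n + 1 - k = n - k + 1 by omega]
    nlinarith [mul_nonneg (sub_nonneg.2 (hc (n - k))) (sq_nonneg (x k - y))]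
  nlinarith [mul_nonneg (hc0 n) (sq_nonneg (ψ - y))]

theorem aux_sum_s13 (c x : ℕ → ℝ) (hc : ∀ k, c (k + 1) ≤ c k) (hc0 : ∀ k, 0 ≤ c k) (ψ : ℝ) (m : ℕ) :
    ∑ n ∈ Finset.Icc 1 m,
      (c 0 * x n - (∑ k ∈ Finset.Icc 1 (n - 1), (c (n - k - 1) - c (n - k)) * x k)
        - c (n - 1) * ψ) * x n
      ≥ (∑ k ∈ Finset.Icc 1 m, c (m - k) * x k ^ 2) / 2
        - (∑ k ∈ Finset.range m, c k) * ψ ^ 2 / 2 := by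
  induction m with
  | zero => simp
  | succ m ih =>
    rw [Finset.sum_Icc_succ_top (by omega), Finset.sum_Icc_succ_top (by omega),
      Finset.sum_range_succ]
    have h := aux_young m c x hc hc0 (x (m + 1)) ψ
    simp only [Nat.add_sub_cancel, Nat.sub_self] at h ⊢
    have e : ∑ k ∈ Finset.Icc 1 m, (c (m - k) - c (m + 1 - k)) * x k ^ 2
        = ∑ k ∈ Finset.Icc 1 m, c (m - k) * x k ^ 2
          - ∑ k ∈ Finset.Icc 1 m, c (m + 1 - k) * x k ^ 2 := by
      rw [← Finset.sum_sub_distrib]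
      exact Finset.sum_congr rfl fun k _ => by ring
    rw [e] at h
    linarith

theorem aux_conc_s13 (a : ℝ) (ha : 0 < a) (ha1 : a < 1) (k : ℕ) :
    ((k : ℝ) + 1 + 1) ^ a - ((k : ℝ) + 1) ^ a ≤ ((k : ℝ) + 1) ^ a - (k : ℝ) ^ a := by
  have hmem : (k : ℝ) ∈ Set.Ici (0 : ℝ) := Set.mem_Ici.2 (Nat.cast_nonneg k)
  have hmem2 : (k : ℝ) + 1 + 1 ∈ Set.Ici (0 : ℝ) := by
    simp only [Set.mem_Ici]
    positivity
  have h := (Real.concaveOn_rpow ha.le ha1.le).2 hmem hmem2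
    (show (0 : ℝ) ≤ 1 / 2 by norm_num) (show (0 : ℝ) ≤ 1 / 2 by norm_num) (by norm_num)
  simp only [smul_eq_mul] at h
  rw [show (1 / 2 * (k : ℝ) + 1 / 2 * ((k : ℝ) + 1 + 1)) = (k : ℝ) + 1 by ring] at h
  linarith

theorem aux_bern (a : ℝ) (ha : 0 < a) (ha1 : a < 1) (k : ℕ) :
    a * ((k : ℝ) + 1) ^ (a - 1) ≤ ((k : ℝ) + 1) ^ a - (k : ℝ) ^ a := by
  have hk : (0 : ℝ) < (k : ℝ) + 1 := by positivity
  have hs : (-1 : ℝ) ≤ -(1 / ((k : ℝ) + 1)) := by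
    rw [neg_le_neg_iff, div_le_one hk]
    linarith [(Nat.cast_nonneg k : (0 : ℝ) ≤ k)]
  have h := rpow_one_add_le_one_add_mul_self hs ha.le ha1.le
  rw [show 1 + -(1 / ((k : ℝ) + 1)) = k / ((k : ℝ) + 1) by field_simp; ring,
    Real.div_rpow (by positivity) hk.le, div_le_iff₀ (Real.rpow_pos_of_pos hk a)] at h
  rw [Real.rpow_sub_one hk.ne']
  have e : (1 + a * -(1 / ((k : ℝ) + 1))) * ((k : ℝ) + 1) ^ a
    = ((k : ℝ) + 1) ^ a - a * (((k : ℝ) + 1) ^ a / ((k : ℝ) + 1)) := by ring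
  linarith

theorem aux_point (a τ : ℝ) (ha : 0 < a) (ha1 : a < 1) (hτ : 0 < τ) (m : ℕ) (hm : 1 ≤ m)
    (c x : ℕ → ℝ)
    (hc : ∀ k : ℕ, c k = τ ^ a / a * (((k : ℝ) + 1) ^ a - (k : ℝ) ^ a)) (ψ : ℝ) :
    ∑ n ∈ Finset.Icc 1 m,
      (c 0 * x n - (∑ k ∈ Finset.Icc 1 (n - 1), (c (n - k - 1) - c (n - k)) * x k)
        - c (n - 1) * ψ) * x n
      ≥ τ * ((m : ℝ) * τ) ^ (a - 1) / 2 * (∑ k ∈ Finset.Icc 1 m, x k ^ 2)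
        - ((m : ℝ) * τ) ^ a / (2 * a) * ψ ^ 2 := by
  have hτa : 0 < τ ^ a / a := div_pos (Real.rpow_pos_of_pos hτ a) ha
  have hanti : ∀ k, c (k + 1) ≤ c k := by
    intro k
    rw [hc, hc]
    push_cast
    exact mul_le_mul_of_nonneg_left (aux_conc_s13 a ha ha1 k) hτa.le
  have hanti' : Antitone c := antitone_nat_of_succ_le hanti
  have hlow : ∀ k : ℕ, τ * (((k : ℝ) + 1) * τ) ^ (a - 1) ≤ c k := by
    intro k
    rw [hc]
    have h := mul_le_mul_of_nonneg_left (aux_bern a ha ha1 k) hτa.le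
    refine le_trans (le_of_eq ?_) h
    rw [Real.mul_rpow (by positivity) hτ.le, Real.rpow_sub_one hτ.ne']
    field_simp
  have hc0 : ∀ k, 0 ≤ c k := fun k => le_trans (by positivity) (hlow k)
  have h := aux_sum_s13 c x hanti hc0 ψ m
  have hsum : ∑ k ∈ Finset.range m, c k = ((m : ℝ) * τ) ^ a / a := by
    simp_rw [hc]
    rw [← Finset.mul_sum]
    have := Finset.sum_range_sub (fun k : ℕ => (k : ℝ) ^ a) m
    push_cast at this
    rw [this, Real.zero_rpow ha.ne', Real.mul_rpow (by positivity) hτ.le]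
    ring
  have hd : τ * ((m : ℝ) * τ) ^ (a - 1) * (∑ k ∈ Finset.Icc 1 m, x k ^ 2)
      ≤ ∑ k ∈ Finset.Icc 1 m, c (m - k) * x k ^ 2 := by
    rw [Finset.mul_sum]
    apply Finset.sum_le_sum
    intro k hk
    simp at hk
    apply mul_le_mul_of_nonneg_right _ (sq_nonneg _)
    have h1 := hlow (m - 1)
    rw [Nat.cast_sub hm] at h1
    simp only [Nat.cast_one, sub_add_cancel] at h1
    exact h1.trans (hanti' (by omega))
  rw [hsum] at h
  have e : ((m : ℝ) * τ) ^ a / (2 * a) * ψ ^ 2 = ((m : ℝ) * τ) ^ a / a * ψ ^ 2 / 2 := by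
    field_simp
  rw [e]
  linarith

theorem stmt_13 (M₁ M₂ : ℕ) (hM₁ : 2 ≤ M₁) (hM₂ : 2 ≤ M₂)
    (h₁ h₂ : ℝ) (hh₁ : 0 < h₁) (hh₂ : 0 < h₂)
    (K : ℕ) (hK : 1 ≤ K) (Δβ : ℝ) (hΔβ : 0 < Δβ)
    (β p : ℕ → ℝ)
    (hβ : ∀ l ∈ Finset.Icc 1 K, 1 < β l ∧ β l < 2)
    (hp : ∀ l ∈ Finset.Icc 1 K, 0 < p l)
    (τ : ℝ) (hτ : 0 < τ) (m : ℕ) (hm : 1 ≤ m)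
    (b : ℕ → ℕ → ℝ)
    (hb : ∀ l ∈ Finset.Icc 1 K, ∀ k : ℕ,
      b l k = τ ^ (2 - β l) / (2 - β l) * (((k : ℝ) + 1) ^ (2 - β l) - (k : ℝ) ^ (2 - β l)))
    (Km : ℝ)
    (hKm : Km = Δβ * ∑ l ∈ Finset.Icc 1 K,
      p l * ((m : ℝ) * τ) ^ (1 - β l) / Real.Gamma (2 - β l))
    (ε : ℕ → ℕ → ℕ → ℝ) (ψ : ℕ → ℕ → ℝ)
    (δ : ℕ → ℕ → ℕ → ℝ)
    (hδ : ∀ n i j : ℕ, δ n i j = (ε n i j - ε (n - 1) i j) / τ) :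
    0 < Km ∧
    Δβ * ∑ l ∈ Finset.Icc 1 K,
        p l * (1 / Real.Gamma (2 - β l)) *
          (h₁ * h₂ * ∑ i ∈ Finset.Icc 1 (M₁ - 1), ∑ j ∈ Finset.Icc 1 (M₂ - 1),
            ∑ n ∈ Finset.Icc 1 m,
              (b l 0 * δ n i j
                - (∑ k ∈ Finset.Icc 1 (n - 1), (b l (n - k - 1) - b l (n - k)) * δ k i j)
                - b l (n - 1) * ψ i j) * δ n i j)
      ≥ τ * Km / 2 * ∑ n ∈ Finset.Icc 1 m, gridNormSq h₁ h₂ M₁ M₂ (fun i j => δ n i j)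
        - Δβ * (∑ l ∈ Finset.Icc 1 K,
            p l * ((m : ℝ) * τ) ^ (2 - β l) / (2 * Real.Gamma (3 - β l))) *
          gridNormSq h₁ h₂ M₁ M₂ ψ := by
  have hG : ∀ l ∈ Finset.Icc 1 K, 0 < Real.Gamma (2 - β l) := fun l hl =>
    Real.Gamma_pos_of_pos (by linarith [(hβ l hl).2])
  have hm0 : (0 : ℝ) < m := by exact_mod_cast hm
  constructor
  · rw [hKm]
    apply mul_pos hΔβ
    apply Finset.sum_pos
    · intro l hl
      have := hG l hl
      have := hp l hl
      positivity
    · exact ⟨1, by simp; omega⟩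
  · set N := ∑ n ∈ Finset.Icc 1 m, gridNormSq h₁ h₂ M₁ M₂ (fun i j => δ n i j) with hN
    have hN' : N = h₁ * h₂ * ∑ i ∈ Finset.Icc 1 (M₁ - 1), ∑ j ∈ Finset.Icc 1 (M₂ - 1),
        ∑ n ∈ Finset.Icc 1 m, δ n i j ^ 2 := by
      rw [hN]
      simp only [gridNormSq]
      rw [← Finset.mul_sum, Finset.sum_comm]
      congr 1
      apply Finset.sum_congr rfl
      intro i _
      rw [Finset.sum_comm]
    have key : τ * Km / 2 * N - Δβ * (∑ l ∈ Finset.Icc 1 K,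
            p l * ((m : ℝ) * τ) ^ (2 - β l) / (2 * Real.Gamma (3 - β l))) *
          gridNormSq h₁ h₂ M₁ M₂ ψ
        = Δβ * ∑ l ∈ Finset.Icc 1 K, (p l * (1 / Real.Gamma (2 - β l)) *
          (τ * ((m : ℝ) * τ) ^ (1 - β l) / 2 * N)
          - p l * ((m : ℝ) * τ) ^ (2 - β l) / (2 * Real.Gamma (3 - β l)) *
            gridNormSq h₁ h₂ M₁ M₂ ψ) := by
      rw [Finset.sum_sub_distrib, ← Finset.sum_mul, mul_sub, hKm, ← mul_assoc Δβ (Finset.sum _ _) (gridNormSq _ _ _ _ _)]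
      congr 1
      simp only [Finset.mul_sum, Finset.sum_mul, Finset.sum_div]
      exact Finset.sum_congr rfl fun l _ => by ring
    rw [key, ge_iff_le]
    apply mul_le_mul_of_nonneg_left _ hΔβ.le
    apply Finset.sum_le_sum
    intro l hl
    have hg := hG l hl
    have hpl := hp l hl
    obtain ⟨hb1, hb2⟩ := hβ l hl
    have ha : 0 < 2 - β l := by linarith
    have e3 : Real.Gamma (3 - β l) = (2 - β l) * Real.Gamma (2 - β l) := by
      rw [← Real.Gamma_add_one ha.ne']
      congr 1
      ring
    have e4 : p l * (1 / Real.Gamma (2 - β l)) * (τ * ((m : ℝ) * τ) ^ (1 - β l) / 2 * N)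
          - p l * ((m : ℝ) * τ) ^ (2 - β l) / (2 * Real.Gamma (3 - β l)) *
            gridNormSq h₁ h₂ M₁ M₂ ψ
        = p l * (1 / Real.Gamma (2 - β l)) * (τ * ((m : ℝ) * τ) ^ (1 - β l) / 2 * N
          - ((m : ℝ) * τ) ^ (2 - β l) / (2 * (2 - β l)) * gridNormSq h₁ h₂ M₁ M₂ ψ) := by
      rw [e3]
      field_simp
    rw [e4]
    apply mul_le_mul_of_nonneg_left _ (by positivity)
    rw [hN', gridNormSq, mul_left_comm, mul_left_comm _ (h₁ * h₂), ← mul_sub]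
    apply mul_le_mul_of_nonneg_left _ (by positivity)
    simp only [Finset.mul_sum (Finset.Icc 1 (M₁ - 1)), Finset.mul_sum (Finset.Icc 1 (M₂ - 1)),
      ← Finset.sum_sub_distrib]
    apply Finset.sum_le_sum
    intro i _
    apply Finset.sum_le_sum
    intro j _
    have h := aux_point (2 - β l) τ ha (by linarith) hτ m hm (b l) (fun n => δ n i j)
      (hb l hl) (ψ i j)
    rw [show 2 - β l - 1 = 1 - β l by ring] at h
    exact h
end

section
/- (Convergence of the ADI scheme.) Let $T>0$, $N\ge1$, $\tau=T/N$, $t_n=n\tau$, let $K\ge1$, $\Delta\beta>0$, $\beta_1,\dots,\beta_K\in(1,2)$, $p_1,\dots,p_K>0$, set $a_k^{(\beta_l)}=(k+1)^{2-\beta_l}-k^{2-\beta_l}$ and $\mu=\Delta\beta\sum_{l=1}^{K}p_l\frac{\tau^{-\beta_l}}{\Gamma(3-\beta_l)}$, and let $f$ satisfy $|f(i,j,t,u_1)-f(i,j,t,u_2)|\le L_f|u_1-u_2|$ for a constant $L_f>0$. Let $U^0,\dots,U^N$ and $u^0,\dots,u^N$ be grid functions, and set $e^n=U^n-u^n$.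 Suppose $e^0_{ij}=0$ for all interior $(i,j)$, $e^n_{ij}=0$ for all boundary indices and all $n$, and that there are grid values $r^{n-1/2}_{ij}$ with $|r^{n-1/2}_{ij}|\le C_0(\tau+h_1^2+h_2^2+\Delta\beta^2)$ for a constant $C_0>0$ such that for all interior $(i,j)$ and $1\le n\le N$: $\Delta\beta\sum_{l=1}^{K}p_l\frac{\tau^{1-\beta_l}}{\Gamma(3-\beta_l)}\big[a_0^{(\beta_l)}\delta_t e^{n-1/2}_{ij}-\sum_{k=1}^{n-1}(a_{n-k-1}^{(\beta_l)}-a_{n-k}^{(\beta_l)})\delta_t e^{k-1/2}_{ij}\big]+\frac{1}{4\mu}\delta_x^2\delta_y^2(e^n_{ij}-e^{n-1}_{ij})=\delta_x^2 e^{n-1/2}_{ij}+\delta_y^2 e^{n-1/2}_{ij}+f(i,j,t_{n-1},U^{n-1}_{ij})-f(i,j,t_{n-1},u^{n-1}_{ij})+r^{n-1/2}_{ij}$. Then there exists a constant $C>0$ depending only on $T$, $L_1$, $L_2$, $L_f$, $C_0$, $K$, $\Delta\beta$, the $\beta_l$ and the $p_l$ (and not on $\tau$, $h_1$, $h_2$,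 or $n$) such that $\|e^n\|\le C\big(\tau+h_1^2+h_2^2+\Delta\beta^2\big)$ for all $0\le n\le N$. -/
open Finset

/-- Second difference in the x-direction. -/
noncomputable def deltaXSq (h₁ : ℝ) (w : ℕ → ℕ → ℝ) (i j : ℕ) : ℝ :=
  (w (i + 1) j - 2 * w i j + w (i - 1) j) / h₁ ^ 2

/-- Second difference in the y-direction. -/
noncomputable def deltaYSq (h₂ : ℝ) (w : ℕ → ℕ → ℝ) (i j : ℕ) : ℝ :=
  (w i (j + 1) - 2 * w i j + w i (j - 1)) / h₂ ^ 2

/-- The coefficients a_k^{(β)} = (k+1)^{2-β} - k^{2-β}. -/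
noncomputable def aCoef (β : ℝ) (k : ℕ) : ℝ :=
  ((k : ℝ) + 1) ^ (2 - β) - (k : ℝ) ^ (2 - β)

theorem byParts (u v : ℕ → ℝ) (h0 : v 0 = 0) (m : ℕ) :
    ∑ i ∈ Icc 1 m, (u (i+1) - 2 * u i + u (i-1)) * v i
      = -∑ i ∈ range (m+1), (u (i+1) - u i) * (v (i+1) - v i) + (u (m+1) - u m) * v (m+1) := by
  induction m with
  | zero => simp [h0]
  | succ m ih =>
    rw [Finset.sum_Icc_succ_top (by omega), ih, Finset.sum_range_succ _ (m+1)]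
    simp only [Nat.add_sub_cancel]
    ring

theorem byParts' (u v : ℕ → ℝ) (M : ℕ) (hM : 1 ≤ M) (h0 : v 0 = 0) (hv : v M = 0) :
    ∑ i ∈ Icc 1 (M-1), (u (i+1) - 2 * u i + u (i-1)) * v i
      = -∑ i ∈ range M, (u (i+1) - u i) * (v (i+1) - v i) := by
  obtain ⟨m, rfl⟩ : ∃ m, M = m + 1 := ⟨M - 1, by omega⟩
  have := byParts u v h0 m
  simp only [Nat.add_sub_cancel]
  rw [this, hv]; ring

theorem coercive_aux (b : ℕ → ℝ) (hb : ∀ k, b (k+1) ≤ b k) (w : ℕ → ℝ) (m : ℕ) :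
    ∑ n ∈ Icc 1 m, (1/2) * ((b (n-1) + b (m-n)) * w n ^ 2) ≤
    ∑ n ∈ Icc 1 m, (b 0 * w n - ∑ k ∈ Icc 1 (n-1), (b (n-k-1) - b (n-k)) * w k) * w n := by
  induction m with
  | zero => simp
  | succ m ih =>
    rw [Finset.sum_Icc_succ_top (by omega), Finset.sum_Icc_succ_top (by omega)]
    simp only [Nat.add_sub_cancel, Nat.sub_self]
    have tel : ∑ k ∈ Icc 1 m, (b (m+1-k-1) - b (m+1-k)) = b 0 - b m := by
      clear ih
      have h1 := Finset.sum_range_sub' b m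
      rw [← h1]
      refine Finset.sum_bij' (fun k _ => m - k) (fun k _ => m - k) ?_ ?_ ?_ ?_ ?_
      · intro k hk; simp only [Finset.mem_Icc, Finset.mem_range] at *; omega
      · intro k hk; simp only [Finset.mem_Icc, Finset.mem_range] at *; omega
      · intro k hk; simp only [Finset.mem_Icc, Finset.mem_range] at *; omega
      · intro k hk; simp only [Finset.mem_Icc, Finset.mem_range] at *; omega
      · intro k hk
        simp only [Finset.mem_Icc] at hk
        rw [show m+1-k-1 = m-k by omega, show m+1-k = m-k+1 by omega]
    have h1 : ∑ k ∈ Icc 1 m, (b (m+1-k-1) - b (m+1-k)) * w k * w (m+1) ≤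
        ∑ k ∈ Icc 1 m, ((1/2) * ((b (m+1-k-1) - b (m+1-k)) * w k ^ 2)
          + (1/2) * w (m+1) ^ 2 * (b (m+1-k-1) - b (m+1-k))) := by
      apply Finset.sum_le_sum
      intro k hk
      rw [Finset.mem_Icc] at hk
      have h := hb (m+1-k-1)
      rw [show m+1-k-1+1 = m+1-k by omega] at h
      nlinarith [mul_nonneg (sub_nonneg.2 h) (sq_nonneg (w k - w (m+1)))]
    rw [Finset.sum_add_distrib, ← Finset.mul_sum _ _ ((1/2) * w (m+1) ^ 2), tel] at h1
    have h2 : ∑ n ∈ Icc 1 m, (1/2) * ((b (n-1) + b (m+1-n)) * w n ^ 2)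
        = ∑ n ∈ Icc 1 m, (1/2) * ((b (n-1) + b (m-n)) * w n ^ 2)
          - ∑ k ∈ Icc 1 m, (1/2) * ((b (m+1-k-1) - b (m+1-k)) * w k ^ 2) := by
      rw [← Finset.sum_sub_distrib]
      apply Finset.sum_congr rfl
      intro k hk
      rw [Finset.mem_Icc] at hk
      rw [show m+1-k-1 = m-k by omega]
      ring
    rw [h2, sub_mul, Finset.sum_mul]
    nlinarith

theorem coercive (b : ℕ → ℝ) (hb : ∀ k, b (k+1) ≤ b k) (w : ℕ → ℝ) (m : ℕ) (κ : ℝ)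
    (hκ : ∀ k, k < m → κ ≤ b k) :
    κ * ∑ n ∈ Icc 1 m, w n ^ 2 ≤
    ∑ n ∈ Icc 1 m, (b 0 * w n - ∑ k ∈ Icc 1 (n-1), (b (n-k-1) - b (n-k)) * w k) * w n := by
  refine le_trans ?_ (coercive_aux b hb w m)
  rw [Finset.mul_sum]
  apply Finset.sum_le_sum
  intro n hn
  rw [Finset.mem_Icc] at hn
  have h1 := hκ (n-1) (by omega)
  have h2 := hκ (m-n) (by omega)
  nlinarith [sq_nonneg (w n)]

theorem aCoef_anti (β : ℝ) (h1 : 1 < β) (h2 : β < 2) (k : ℕ) : aCoef β (k+1) ≤ aCoef β k := by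
  have hc := Real.concaveOn_rpow (p := 2 - β) (by linarith) (by linarith)
  have h := hc.2 (show (k:ℝ) ∈ Set.Ici (0:ℝ) by simp)
    (show (k:ℝ)+2 ∈ Set.Ici (0:ℝ) by rw [Set.mem_Ici]; positivity)
    (show (0:ℝ) ≤ 1/2 by norm_num) (show (0:ℝ) ≤ 1/2 by norm_num) (by norm_num)
  simp only [smul_eq_mul] at h
  rw [show (1/2 * (k:ℝ) + 1/2 * ((k:ℝ)+2)) = k + 1 by ring] at h
  unfold aCoef
  push_cast
  rw [show (k:ℝ) + 1 + 1 = k + 2 by ring]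
  linarith

theorem aCoef_lower (β T τ : ℝ) (h1 : 1 < β) (h2 : β < 2) (hτ : 0 < τ) (k : ℕ)
    (hk : ((k:ℝ)+1) * τ ≤ T) : (2 - β) * T ^ (1 - β) ≤ τ ^ (1 - β) * aCoef β k := by
  have hk0 : (0:ℝ) < (k:ℝ)+1 := by positivity
  have hb : (k:ℝ) ^ (2-β) ≤ ((k:ℝ)+1) ^ (2-β) * (1 + (2-β) * (-1/((k:ℝ)+1))) := by
    have hs : -1 ≤ -1/((k:ℝ)+1) := by
      rw [le_div_iff₀ hk0]; linarith [(Nat.cast_nonneg k : (0:ℝ) ≤ k)]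
    have := rpow_one_add_le_one_add_mul_self hs (p := 2-β) (by linarith) (by linarith)
    have he : (k:ℝ) = ((k:ℝ)+1) * (1 + -1/((k:ℝ)+1)) := by field_simp; ring
    calc (k:ℝ) ^ (2-β) = (((k:ℝ)+1) * (1 + -1/((k:ℝ)+1))) ^ (2-β) := by rw [← he]
      _ = ((k:ℝ)+1) ^ (2-β) * (1 + -1/((k:ℝ)+1)) ^ (2-β) := by
        rw [Real.mul_rpow hk0.le (by linarith)]
      _ ≤ _ := by gcongr
  have hpow : ((k:ℝ)+1) ^ (2-β) = ((k:ℝ)+1) ^ (1-β) * ((k:ℝ)+1) := by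
    rw [show 2-β = (1-β) + 1 by ring, Real.rpow_add_one hk0.ne']
  have ha : (2-β) * ((k:ℝ)+1) ^ (1-β) ≤ aCoef β k := by
    unfold aCoef
    have : ((k:ℝ)+1) ^ (2-β) * (1 + (2-β) * (-1/((k:ℝ)+1)))
        = ((k:ℝ)+1) ^ (2-β) - (2-β) * ((k:ℝ)+1) ^ (1-β) := by
      rw [hpow]; field_simp; ring
    linarith
  have hT : T ^ (1-β) ≤ (((k:ℝ)+1) * τ) ^ (1-β) :=
    Real.rpow_le_rpow_of_nonpos (by positivity) hk (by linarith)
  rw [Real.mul_rpow hk0.le hτ.le] at hT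
  calc (2 - β) * T ^ (1 - β) ≤ (2-β) * (((k:ℝ)+1) ^ (1-β) * τ ^ (1-β)) := by
        apply mul_le_mul_of_nonneg_left hT; linarith
    _ = τ ^ (1-β) * ((2-β) * ((k:ℝ)+1) ^ (1-β)) := by ring
    _ ≤ _ := by gcongr

theorem gronwall_d (E : ℕ → ℝ) (a B : ℝ) (ha : 0 ≤ a) (N : ℕ)
    (h : ∀ m ≤ N, E m ≤ a * ∑ k ∈ range m, E k + B) :
    ∀ m ≤ N, E m ≤ B * (1 + a) ^ m := by
  have hS : ∀ m ≤ N, a * ∑ k ∈ range m, E k + B ≤ B * (1 + a) ^ m := by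
    intro m
    induction m with
    | zero => simp
    | succ m ih =>
      intro hm
      have h1 := ih (by omega)
      have h2 := h m (by omega)
      rw [Finset.sum_range_succ, pow_succ]
      nlinarith
  intro m hm
  exact (h m hm).trans (hS m hm)

/-- zero on the boundary -/
def ZeroB (M₁ M₂ : ℕ) (v : ℕ → ℕ → ℝ) : Prop :=
  ∀ i j : ℕ, i ≤ M₁ → j ≤ M₂ → (i = 0 ∨ i = M₁ ∨ j = 0 ∨ j = M₂) → v i j = 0

/-- discrete H1 energy -/
noncomputable def gEn (h₁ h₂ : ℝ) (M₁ M₂ : ℕ) (v : ℕ → ℕ → ℝ) : ℝ :=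
  (∑ j ∈ Icc 1 (M₂-1), ∑ i ∈ range M₁, (v (i+1) j - v i j) ^ 2) / h₁ ^ 2
  + (∑ i ∈ Icc 1 (M₁-1), ∑ j ∈ range M₂, (v i (j+1) - v i j) ^ 2) / h₂ ^ 2

theorem gEn_nonneg (h₁ h₂ : ℝ) (M₁ M₂ : ℕ) (v : ℕ → ℕ → ℝ) : 0 ≤ gEn h₁ h₂ M₁ M₂ v := by
  unfold gEn; positivity

theorem sumX (h₁ : ℝ) (M₁ M₂ : ℕ) (hM₁ : 1 ≤ M₁) (u v : ℕ → ℕ → ℝ)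
    (hv : ZeroB M₁ M₂ v) :
    ∑ i ∈ Icc 1 (M₁-1), ∑ j ∈ Icc 1 (M₂-1), deltaXSq h₁ u i j * v i j
      = -(∑ j ∈ Icc 1 (M₂-1), ∑ i ∈ range M₁,
          (u (i+1) j - u i j) * (v (i+1) j - v i j)) / h₁ ^ 2 := by
  rw [Finset.sum_comm, ← Finset.sum_neg_distrib, Finset.sum_div]
  apply Finset.sum_congr rfl
  intro j hj
  rw [Finset.mem_Icc] at hj
  rw [← byParts' (fun i => u i j) (fun i => v i j) M₁ hM₁
    (hv 0 j (by omega) (by omega) (by simp)) (hv M₁ j (by omega) (by omega) (by simp)),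
    Finset.sum_div]
  apply Finset.sum_congr rfl
  intro i hi
  unfold deltaXSq
  ring

theorem sumY (h₂ : ℝ) (M₁ M₂ : ℕ) (hM₂ : 1 ≤ M₂) (u v : ℕ → ℕ → ℝ)
    (hv : ZeroB M₁ M₂ v) :
    ∑ i ∈ Icc 1 (M₁-1), ∑ j ∈ Icc 1 (M₂-1), deltaYSq h₂ u i j * v i j
      = -(∑ i ∈ Icc 1 (M₁-1), ∑ j ∈ range M₂,
          (u i (j+1) - u i j) * (v i (j+1) - v i j)) / h₂ ^ 2 := by
  rw [← Finset.sum_neg_distrib, Finset.sum_div]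
  apply Finset.sum_congr rfl
  intro i hi
  rw [Finset.mem_Icc] at hi
  rw [← byParts' (fun j => u i j) (fun j => v i j) M₂ hM₂
    (hv i 0 (by omega) (by omega) (by simp)) (hv i M₂ (by omega) (by omega) (by simp)),
    Finset.sum_div]
  apply Finset.sum_congr rfl
  intro j hj
  unfold deltaYSq
  ring

theorem sumXY_nonneg (h₁ h₂ : ℝ) (M₁ M₂ : ℕ) (hM₁ : 1 ≤ M₁) (hM₂ : 1 ≤ M₂) (v : ℕ → ℕ → ℝ)
    (hv : ZeroB M₁ M₂ v) :
    0 ≤ ∑ i ∈ Icc 1 (M₁-1), ∑ j ∈ Icc 1 (M₂-1),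
      deltaXSq h₁ (fun i' j' => deltaYSq h₂ v i' j') i j * v i j := by
  rw [sumX h₁ M₁ M₂ hM₁ _ v hv]
  apply div_nonneg _ (sq_nonneg _)
  rw [Finset.sum_comm, ← Finset.sum_neg_distrib]
  apply Finset.sum_nonneg
  intro i hi
  rw [Finset.mem_range] at hi
  have h := byParts' (fun j => v (i+1) j - v i j) (fun j => v (i+1) j - v i j) M₂ hM₂
    (by simp [hv (i+1) 0 (by omega) (by omega) (by simp), hv i 0 (by omega) (by omega) (by simp)])
    (by simp [hv (i+1) M₂ (by omega) (by omega) (by simp),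
      hv i M₂ (by omega) (by omega) (by simp)])
  have h2 : ∑ j ∈ Icc 1 (M₂-1), (deltaYSq h₂ v (i+1) j - deltaYSq h₂ v i j)
        * (v (i+1) j - v i j)
      = (-∑ j ∈ range M₂, ((v (i+1) (j+1) - v i (j+1)) - (v (i+1) j - v i j)) *
          ((v (i+1) (j+1) - v i (j+1)) - (v (i+1) j - v i j))) / h₂ ^ 2 := by
    rw [← h, Finset.sum_div]
    apply Finset.sum_congr rfl
    intro j hj
    unfold deltaYSq
    ring
  rw [h2, neg_div, neg_neg]
  apply div_nonneg _ (sq_nonneg _)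
  exact Finset.sum_nonneg fun j _ => mul_self_nonneg _

theorem sumLap (h₁ h₂ : ℝ) (M₁ M₂ : ℕ) (hM₁ : 1 ≤ M₁) (hM₂ : 1 ≤ M₂) (v v' : ℕ → ℕ → ℝ)
    (hv : ZeroB M₁ M₂ v) (hv' : ZeroB M₁ M₂ v') :
    ∑ i ∈ Icc 1 (M₁-1), ∑ j ∈ Icc 1 (M₂-1),
      (deltaXSq h₁ (fun a b => (v a b + v' a b) / 2) i j
        + deltaYSq h₂ (fun a b => (v a b + v' a b) / 2) i j) * (v i j - v' i j)
      = -(1/2) * (gEn h₁ h₂ M₁ M₂ v - gEn h₁ h₂ M₁ M₂ v') := by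
  have hd : ZeroB M₁ M₂ (fun a b => v a b - v' a b) := by
    intro i j hi hj h
    simp [hv i j hi hj h, hv' i j hi hj h]
  simp only [add_mul, Finset.sum_add_distrib]
  rw [sumX h₁ M₁ M₂ hM₁ _ _ hd, sumY h₂ M₁ M₂ hM₂ _ _ hd]
  have e1 : ∀ (s t : Finset ℕ) (A B : ℕ → ℕ → ℝ),
      ∑ x ∈ s, ∑ y ∈ t, (1/2) * (A x y ^ 2 - B x y ^ 2)
      = (1/2) * (∑ x ∈ s, ∑ y ∈ t, A x y ^ 2 - ∑ x ∈ s, ∑ y ∈ t, B x y ^ 2) := by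
    intro s t A B
    simp only [← Finset.mul_sum, Finset.sum_sub_distrib]
  have hx : ∑ j ∈ Icc 1 (M₂-1), ∑ i ∈ range M₁,
      ((v (i+1) j + v' (i+1) j) / 2 - (v i j + v' i j) / 2)
        * ((v (i+1) j - v' (i+1) j) - (v i j - v' i j))
      = (1/2) * (∑ j ∈ Icc 1 (M₂-1), ∑ i ∈ range M₁, (v (i+1) j - v i j) ^ 2
        - ∑ j ∈ Icc 1 (M₂-1), ∑ i ∈ range M₁, (v' (i+1) j - v' i j) ^ 2) := by
    rw [← e1 _ _ (fun j i => v (i+1) j - v i j) (fun j i => v' (i+1) j - v' i j)]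
    refine Finset.sum_congr rfl fun j _ => Finset.sum_congr rfl fun i _ => ?_
    ring
  have hy : ∑ i ∈ Icc 1 (M₁-1), ∑ j ∈ range M₂,
      ((v i (j+1) + v' i (j+1)) / 2 - (v i j + v' i j) / 2)
        * ((v i (j+1) - v' i (j+1)) - (v i j - v' i j))
      = (1/2) * (∑ i ∈ Icc 1 (M₁-1), ∑ j ∈ range M₂, (v i (j+1) - v i j) ^ 2
        - ∑ i ∈ Icc 1 (M₁-1), ∑ j ∈ range M₂, (v' i (j+1) - v' i j) ^ 2) := by
    rw [← e1 _ _ (fun i j => v i (j+1) - v i j) (fun i j => v' i (j+1) - v' i j)]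
    refine Finset.sum_congr rfl fun j _ => Finset.sum_congr rfl fun i _ => ?_
    ring
  rw [hx, hy]
  unfold gEn
  ring

theorem stepIneq (h₁ h₂ ν : ℝ) (hν : 0 ≤ ν) (M₁ M₂ : ℕ) (hM₁ : 1 ≤ M₁) (hM₂ : 1 ≤ M₂)
    (v v' A F : ℕ → ℕ → ℝ) (hv : ZeroB M₁ M₂ v) (hv' : ZeroB M₁ M₂ v')
    (heq : ∀ i j : ℕ, 1 ≤ i → i ≤ M₁ - 1 → 1 ≤ j → j ≤ M₂ - 1 →
      A i j + ν * deltaXSq h₁ (fun i' j' =>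
                  deltaYSq h₂ (fun a b => v a b - v' a b) i' j') i j
       = deltaXSq h₁ (fun a b => (v a b + v' a b) / 2) i j
        + deltaYSq h₂ (fun a b => (v a b + v' a b) / 2) i j + F i j) :
    ∑ i ∈ Icc 1 (M₁-1), ∑ j ∈ Icc 1 (M₂-1), A i j * (v i j - v' i j) ≤
      -(1/2) * (gEn h₁ h₂ M₁ M₂ v - gEn h₁ h₂ M₁ M₂ v')
      + ∑ i ∈ Icc 1 (M₁-1), ∑ j ∈ Icc 1 (M₂-1), F i j * (v i j - v' i j) := by
  have hd : ZeroB M₁ M₂ (fun a b => v a b - v' a b) := by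
    intro i j hi hj h
    simp [hv i j hi hj h, hv' i j hi hj h]
  have h1 := sumXY_nonneg h₁ h₂ M₁ M₂ hM₁ hM₂ _ hd
  rw [← sumLap h₁ h₂ M₁ M₂ hM₁ hM₂ v v' hv hv', ← Finset.sum_add_distrib]
  have h2 : ∑ i ∈ Icc 1 (M₁-1), ∑ j ∈ Icc 1 (M₂-1), A i j * (v i j - v' i j)
     + ν * ∑ i ∈ Icc 1 (M₁-1), ∑ j ∈ Icc 1 (M₂-1),
      deltaXSq h₁ (fun i' j' => deltaYSq h₂ (fun a b => v a b - v' a b) i' j') i j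
        * (v i j - v' i j) 
     = ∑ i ∈ Icc 1 (M₁-1), (∑ j ∈ Icc 1 (M₂-1),
      (deltaXSq h₁ (fun a b => (v a b + v' a b) / 2) i j
        + deltaYSq h₂ (fun a b => (v a b + v' a b) / 2) i j) * (v i j - v' i j)
      + ∑ j ∈ Icc 1 (M₂-1), F i j * (v i j - v' i j)) := by
    simp only [Finset.mul_sum, ← Finset.sum_add_distrib]
    refine Finset.sum_congr rfl fun i hi => Finset.sum_congr rfl fun j hj => ?_
    rw [Finset.mem_Icc] at hi hj
    have := heq i j hi.1 hi.2 hj.1 hj.2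
    linear_combination (v i j - v' i j) * this
  have h3 := mul_nonneg hν h1
  linarith

theorem energy (h₁ h₂ ν τ κ : ℝ) (hν : 0 ≤ ν) (hτ : 0 < τ) (hκ : 0 < κ) (N M₁ M₂ : ℕ)
    (hM₁ : 1 ≤ M₁) (hM₂ : 1 ≤ M₂) (e w F : ℕ → ℕ → ℕ → ℝ) (b : ℕ → ℝ)
    (hb : ∀ k, b (k+1) ≤ b k) (hbκ : ∀ k, k < N → κ ≤ b k)
    (hw : ∀ n i j, e n i j - e (n-1) i j = τ * w n i j)
    (hz : ∀ n ≤ N, ZeroB M₁ M₂ (e n))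
    (h0 : ∀ i j, i ≤ M₁ → j ≤ M₂ → e 0 i j = 0)
    (heq : ∀ n : ℕ, 1 ≤ n → n ≤ N → ∀ i j : ℕ, 1 ≤ i → i ≤ M₁ - 1 → 1 ≤ j → j ≤ M₂ - 1 →
      (b 0 * w n i j - ∑ k ∈ Icc 1 (n-1), (b (n-k-1) - b (n-k)) * w k i j)
        + ν * deltaXSq h₁ (fun i' j' =>
                  deltaYSq h₂ (fun a b => e n a b - e (n-1) a b) i' j') i j
       = deltaXSq h₁ (fun a b => (e n a b + e (n-1) a b) / 2) i j
        + deltaYSq h₂ (fun a b => (e n a b + e (n-1) a b) / 2) i j + F n i j)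
    (m : ℕ) (hm : m ≤ N) :
    κ ^ 2 * ∑ n ∈ Icc 1 m, ∑ i ∈ Icc 1 (M₁-1), ∑ j ∈ Icc 1 (M₂-1), w n i j ^ 2
      ≤ ∑ n ∈ Icc 1 m, ∑ i ∈ Icc 1 (M₁-1), ∑ j ∈ Icc 1 (M₂-1), F n i j ^ 2 := by
  set A : ℕ → ℕ → ℕ → ℝ := fun n i j =>
    b 0 * w n i j - ∑ k ∈ Icc 1 (n-1), (b (n-k-1) - b (n-k)) * w k i j with hA
  have hG0 : gEn h₁ h₂ M₁ M₂ (e 0) = 0 := by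
    unfold gEn
    rw [Finset.sum_eq_zero, Finset.sum_eq_zero]
    · simp
    · intro i hi
      apply Finset.sum_eq_zero
      intro j hj
      simp only [Finset.mem_Icc, Finset.mem_range] at hi hj
      rw [h0 i (j+1) (by omega) (by omega), h0 i j (by omega) (by omega)]; simp
    · intro j hj
      apply Finset.sum_eq_zero
      intro i hi
      simp only [Finset.mem_Icc, Finset.mem_range] at hi hj
      rw [h0 (i+1) j (by omega) (by omega), h0 i j (by omega) (by omega)]; simp
  have hstep : ∀ m ≤ N, 
      τ * ∑ n ∈ Icc 1 m, ∑ i ∈ Icc 1 (M₁-1), ∑ j ∈ Icc 1 (M₂-1), A n i j * w n i j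
      ≤ -(1/2) * gEn h₁ h₂ M₁ M₂ (e m)
      + τ * ∑ n ∈ Icc 1 m, ∑ i ∈ Icc 1 (M₁-1), ∑ j ∈ Icc 1 (M₂-1), F n i j * w n i j := by
    intro m
    induction m with
    | zero => intro _; simp [hG0]
    | succ m ih =>
      intro hm
      have h1 := ih (by omega)
      have h2 := stepIneq h₁ h₂ ν hν M₁ M₂ hM₁ hM₂ (e (m+1)) (e m) (A (m+1)) (F (m+1))
        (hz _ hm) (hz _ (by omega)) (heq (m+1) (by omega) hm)
      have hw' : ∀ i j, e (m+1) i j - e m i j = τ * w (m+1) i j := fun i j => hw (m+1) i j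
      simp only [hw'] at h2
      have h3 : ∀ Z : ℕ → ℕ → ℝ, ∑ i ∈ Icc 1 (M₁-1), ∑ j ∈ Icc 1 (M₂-1),
          Z i j * (τ * w (m+1) i j)
          = τ * ∑ i ∈ Icc 1 (M₁-1), ∑ j ∈ Icc 1 (M₂-1), Z i j * w (m+1) i j := by
        intro Z
        simp only [Finset.mul_sum]
        refine Finset.sum_congr rfl fun i _ => Finset.sum_congr rfl fun j _ => ?_
        ring
      rw [h3, h3] at h2
      rw [Finset.sum_Icc_succ_top (by omega), Finset.sum_Icc_succ_top (by omega),
        mul_add, mul_add]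
      linarith
  have h1 := hstep m hm
  have hg := gEn_nonneg h₁ h₂ M₁ M₂ (e m)
  have h2 : ∑ n ∈ Icc 1 m, ∑ i ∈ Icc 1 (M₁-1), ∑ j ∈ Icc 1 (M₂-1), A n i j * w n i j
      ≤ ∑ n ∈ Icc 1 m, ∑ i ∈ Icc 1 (M₁-1), ∑ j ∈ Icc 1 (M₂-1), F n i j * w n i j := by
    apply le_of_mul_le_mul_left _ hτ
    linarith
  have swap : ∀ Z : ℕ → ℕ → ℕ → ℝ,
      ∑ n ∈ Icc 1 m, ∑ i ∈ Icc 1 (M₁-1), ∑ j ∈ Icc 1 (M₂-1), Z n i j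
      = ∑ i ∈ Icc 1 (M₁-1), ∑ j ∈ Icc 1 (M₂-1), ∑ n ∈ Icc 1 m, Z n i j := by
    intro Z
    rw [Finset.sum_comm]
    refine Finset.sum_congr rfl fun i _ => ?_
    rw [Finset.sum_comm]
  have h3 : κ * ∑ n ∈ Icc 1 m, ∑ i ∈ Icc 1 (M₁-1), ∑ j ∈ Icc 1 (M₂-1), w n i j ^ 2
      ≤ ∑ n ∈ Icc 1 m, ∑ i ∈ Icc 1 (M₁-1), ∑ j ∈ Icc 1 (M₂-1), A n i j * w n i j := by
    rw [swap, swap]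
    simp only [Finset.mul_sum _ _ κ]
    refine Finset.sum_le_sum fun i _ => Finset.sum_le_sum fun j _ => ?_
    rw [← Finset.mul_sum]
    exact coercive b hb (fun n => w n i j) m κ (fun k hk => hbκ k (by omega))
  have h4 : 2 * κ * ∑ n ∈ Icc 1 m, ∑ i ∈ Icc 1 (M₁-1), ∑ j ∈ Icc 1 (M₂-1), F n i j * w n i j
      ≤ κ ^ 2 * ∑ n ∈ Icc 1 m, ∑ i ∈ Icc 1 (M₁-1), ∑ j ∈ Icc 1 (M₂-1), w n i j ^ 2
      + ∑ n ∈ Icc 1 m, ∑ i ∈ Icc 1 (M₁-1), ∑ j ∈ Icc 1 (M₂-1), F n i j ^ 2 := by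
    simp only [Finset.mul_sum, ← Finset.sum_add_distrib]
    refine Finset.sum_le_sum fun n _ => Finset.sum_le_sum fun i _ =>
      Finset.sum_le_sum fun j _ => ?_
    nlinarith [sq_nonneg (κ * w n i j - F n i j)]
  have h5 := mul_le_mul_of_nonneg_left (h3.trans h2) (show 0 ≤ 2 * κ by positivity)
  nlinarith

theorem norm_rec (τ κ T Lf ρ : ℝ) (hτ : 0 < τ) (hκ : 0 < κ) (hT : 0 < T) (N M₁ M₂ : ℕ)
    (hNT : N * τ = T)
    (e w F : ℕ → ℕ → ℕ → ℝ)
    (hw : ∀ n i j, e n i j - e (n-1) i j = τ * w n i j)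
    (h0 : ∀ i j, i ≤ M₁ → j ≤ M₂ → e 0 i j = 0)
    (hF : ∀ n : ℕ, 1 ≤ n → n ≤ N → ∀ i j : ℕ, 1 ≤ i → i ≤ M₁ - 1 → 1 ≤ j → j ≤ M₂ - 1 →
      |F n i j| ≤ Lf * |e (n-1) i j| + ρ)
    (hen : ∀ m ≤ N,
      κ ^ 2 * ∑ n ∈ Icc 1 m, ∑ i ∈ Icc 1 (M₁-1), ∑ j ∈ Icc 1 (M₂-1), w n i j ^ 2
      ≤ ∑ n ∈ Icc 1 m, ∑ i ∈ Icc 1 (M₁-1), ∑ j ∈ Icc 1 (M₂-1), F n i j ^ 2)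
    (m : ℕ) (hm : m ≤ N) :
    ∑ i ∈ Icc 1 (M₁-1), ∑ j ∈ Icc 1 (M₂-1), e m i j ^ 2 ≤
      (2 * T * Lf ^ 2 / κ ^ 2 * τ) *
        ∑ n ∈ range m, ∑ i ∈ Icc 1 (M₁-1), ∑ j ∈ Icc 1 (M₂-1), e n i j ^ 2
      + 2 * T ^ 2 / κ ^ 2 * ρ ^ 2 * ((M₁-1 : ℕ) * (M₂-1 : ℕ)) := by
  have hmT : (m:ℝ) * τ ≤ T := by
    rw [← hNT]; gcongr
  have hsum : ∀ i j, i ≤ M₁ → j ≤ M₂ → ∀ m, e m i j = τ * ∑ n ∈ Icc 1 m, w n i j := by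
    intro i j hi hj m
    induction m with
    | zero => simp [h0 i j hi hj]
    | succ m ih =>
      rw [Finset.sum_Icc_succ_top (by omega), mul_add, ← ih, ← hw]
      simp
  have h1 : ∑ i ∈ Icc 1 (M₁-1), ∑ j ∈ Icc 1 (M₂-1), e m i j ^ 2
      ≤ T * τ * ∑ n ∈ Icc 1 m, ∑ i ∈ Icc 1 (M₁-1), ∑ j ∈ Icc 1 (M₂-1), w n i j ^ 2 := by
    rw [Finset.sum_comm (s := Icc 1 m)]
    simp only [Finset.mul_sum (Icc 1 (M₁-1))]
    refine Finset.sum_le_sum fun i hi => ?_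
    rw [Finset.sum_comm (s := Icc 1 m)]
    simp only [Finset.mul_sum (Icc 1 (M₂-1))]
    refine Finset.sum_le_sum fun j hj => ?_
    rw [Finset.mem_Icc] at hi hj
    rw [hsum i j (by omega) (by omega) m, mul_pow]
    have hc := sq_sum_le_card_mul_sum_sq (s := Icc 1 m) (f := fun n => w n i j)
    simp only [Nat.card_Icc, Nat.add_sub_cancel] at hc
    have hp : 0 ≤ ∑ n ∈ Icc 1 m, w n i j ^ 2 := Finset.sum_nonneg fun _ _ => sq_nonneg _
    calc τ ^ 2 * (∑ n ∈ Icc 1 m, w n i j) ^ 2 ≤ τ ^ 2 * (m * ∑ n ∈ Icc 1 m, w n i j ^ 2) := by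
          gcongr
      _ = (m * τ) * τ * ∑ n ∈ Icc 1 m, w n i j ^ 2 := by ring
      _ ≤ _ := by gcongr
  have h2 : ∑ n ∈ Icc 1 m, ∑ i ∈ Icc 1 (M₁-1), ∑ j ∈ Icc 1 (M₂-1), F n i j ^ 2
      ≤ ∑ n ∈ Icc 1 m, (2 * Lf ^ 2 * (∑ i ∈ Icc 1 (M₁-1), ∑ j ∈ Icc 1 (M₂-1), e (n-1) i j ^ 2)
         + 2 * ρ ^ 2 * ((M₁-1 : ℕ) * (M₂-1 : ℕ))) := by
    refine Finset.sum_le_sum fun n hn => ?_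
    have hc : 2 * ρ ^ 2 * (((M₁-1 : ℕ) : ℝ) * (M₂-1 : ℕ))
        = ∑ i ∈ Icc 1 (M₁-1), ∑ j ∈ Icc 1 (M₂-1), 2 * ρ ^ 2 := by
      simp; ring
    rw [hc]
    simp only [Finset.mul_sum, ← Finset.sum_add_distrib]
    refine Finset.sum_le_sum fun i hi => Finset.sum_le_sum fun j hj => ?_
    rw [Finset.mem_Icc] at hi hj hn
    have hf := hF n hn.1 (by omega) i j hi.1 hi.2 hj.1 hj.2
    have hf2 := pow_le_pow_left₀ (abs_nonneg _) hf 2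
    rw [sq_abs] at hf2
    nlinarith [sq_nonneg (Lf * |e (n-1) i j| - ρ), sq_abs (e (n-1) i j)]
  have h3 : ∑ n ∈ Icc 1 m, (2 * Lf ^ 2 * (∑ i ∈ Icc 1 (M₁-1), ∑ j ∈ Icc 1 (M₂-1), e (n-1) i j ^ 2)
         + 2 * ρ ^ 2 * (((M₁-1 : ℕ) : ℝ) * (M₂-1 : ℕ)))
      = 2 * Lf ^ 2 * ∑ n ∈ range m, ∑ i ∈ Icc 1 (M₁-1), ∑ j ∈ Icc 1 (M₂-1), e n i j ^ 2
        + m * (2 * ρ ^ 2 * (((M₁-1 : ℕ) : ℝ) * (M₂-1 : ℕ))) := by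
    rw [Finset.sum_add_distrib, ← Finset.mul_sum]
    congr 1
    · congr 1
      rw [Finset.range_eq_Ico, ← Finset.Ico_add_one_right_eq_Icc,
        ← Finset.sum_Ico_add' _ 0 m 1]
      simp
    · simp
  have h4 := (hen m hm).trans (h2.trans h3.le)
  set W := ∑ n ∈ Icc 1 m, ∑ i ∈ Icc 1 (M₁-1), ∑ j ∈ Icc 1 (M₂-1), w n i j ^ 2
  set S := ∑ n ∈ range m, ∑ i ∈ Icc 1 (M₁-1), ∑ j ∈ Icc 1 (M₂-1), e n i j ^ 2
  set c : ℝ := ((M₁-1 : ℕ) : ℝ) * (M₂-1 : ℕ) with hcdef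
  have hc0 : 0 ≤ c := by positivity
  have h5 : W ≤ (2 * Lf ^ 2 * S + m * (2 * ρ ^ 2 * c)) / κ ^ 2 := by
    rw [le_div_iff₀ (by positivity)]; linarith
  calc _ ≤ T * τ * W := h1
    _ ≤ T * τ * ((2 * Lf ^ 2 * S + m * (2 * ρ ^ 2 * c)) / κ ^ 2) := by gcongr
    _ = (2 * T * Lf ^ 2 / κ ^ 2 * τ) * S + (m * τ) * (2 * T / κ ^ 2 * ρ ^ 2 * c) := by ring
    _ ≤ (2 * T * Lf ^ 2 / κ ^ 2 * τ) * S + T * (2 * T / κ ^ 2 * ρ ^ 2 * c) := by gcongr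
    _ = _ := by ring

theorem stmt_15 (T L₁ L₂ Lf C₀ : ℝ) (hT : 0 < T) (hL₁ : 0 < L₁) (hL₂ : 0 < L₂)
    (hLf : 0 < Lf) (hC₀ : 0 < C₀)
    (K : ℕ) (hK : 1 ≤ K) (Δβ : ℝ) (hΔβ : 0 < Δβ) (β p : ℕ → ℝ)
    (hβ : ∀ l ∈ Finset.Icc 1 K, 1 < β l ∧ β l < 2)
    (hp : ∀ l ∈ Finset.Icc 1 K, 0 < p l) :
    ∃ C : ℝ, 0 < C ∧
      ∀ (N M₁ M₂ : ℕ), 1 ≤ N → 2 ≤ M₁ → 2 ≤ M₂ →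
      ∀ (τ h₁ h₂ μ : ℝ), τ = T / N → h₁ = L₁ / M₁ → h₂ = L₂ / M₂ →
        μ = Δβ * ∑ l ∈ Finset.Icc 1 K, p l * (τ ^ (-(β l)) / Real.Gamma (3 - β l)) →
      ∀ f : ℕ → ℕ → ℝ → ℝ → ℝ,
        (∀ i j : ℕ, 1 ≤ i → i ≤ M₁ - 1 → 1 ≤ j → j ≤ M₂ - 1 →
          ∀ t u₁ u₂ : ℝ, |f i j t u₁ - f i j t u₂| ≤ Lf * |u₁ - u₂|) →
      ∀ (U u : ℕ → ℕ → ℕ → ℝ) (e : ℕ → ℕ → ℕ → ℝ) (r : ℕ → ℕ → ℕ → ℝ),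
        (∀ n i j : ℕ, e n i j = U n i j - u n i j) →
        (∀ i j : ℕ, 1 ≤ i → i ≤ M₁ - 1 → 1 ≤ j → j ≤ M₂ - 1 → e 0 i j = 0) →
        (∀ n ≤ N, ∀ i j : ℕ, i ≤ M₁ → j ≤ M₂ →
          (i = 0 ∨ i = M₁ ∨ j = 0 ∨ j = M₂) → e n i j = 0) →
        (∀ n : ℕ, 1 ≤ n → n ≤ N → ∀ i j : ℕ, 1 ≤ i → i ≤ M₁ - 1 → 1 ≤ j → j ≤ M₂ - 1 →
          |r n i j| ≤ C₀ * (τ + h₁ ^ 2 + h₂ ^ 2 + Δβ ^ 2)) →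
        (∀ n : ℕ, 1 ≤ n → n ≤ N → ∀ i j : ℕ, 1 ≤ i → i ≤ M₁ - 1 → 1 ≤ j → j ≤ M₂ - 1 →
          Δβ * (∑ l ∈ Finset.Icc 1 K,
              p l * (τ ^ (1 - β l) / Real.Gamma (3 - β l)) *
                (aCoef (β l) 0 * ((e n i j - e (n - 1) i j) / τ)
                  - (∑ k ∈ Finset.Icc 1 (n - 1),
                      (aCoef (β l) (n - k - 1) - aCoef (β l) (n - k)) *
                        ((e k i j - e (k - 1) i j) / τ))))
            + (1 / (4 * μ)) *
                deltaXSq h₁ (fun i' j' =>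
                  deltaYSq h₂ (fun a b => e n a b - e (n - 1) a b) i' j') i j
            = deltaXSq h₁ (fun a b => (e n a b + e (n - 1) a b) / 2) i j
              + deltaYSq h₂ (fun a b => (e n a b + e (n - 1) a b) / 2) i j
              + f i j (((n : ℝ) - 1) * τ) (U (n - 1) i j)
              - f i j (((n : ℝ) - 1) * τ) (u (n - 1) i j)
              + r n i j) →
        ∀ n : ℕ, n ≤ N →
          Real.sqrt (gridNormSq h₁ h₂ M₁ M₂ (fun i j => e n i j))
            ≤ C * (τ + h₁ ^ 2 + h₂ ^ 2 + Δβ ^ 2) := by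
  set κ : ℝ := Δβ * ∑ l ∈ Finset.Icc 1 K,
    p l * ((2 - β l) * T ^ (1 - β l) / Real.Gamma (3 - β l)) with hκdef
  have hΓ : ∀ l ∈ Finset.Icc 1 K, 0 < Real.Gamma (3 - β l) := fun l hl =>
    Real.Gamma_pos_of_pos (by linarith [(hβ l hl).2])
  have hκ : 0 < κ := by
    apply mul_pos hΔβ
    apply Finset.sum_pos
    · intro l hl
      have h1 := hΓ l hl
      have h2 := hp l hl
      have h3 : 0 < 2 - β l := by linarith [(hβ l hl).2]
      positivity
    · exact ⟨1, by simp [hK]⟩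
  set a : ℝ := 2 * T * Lf ^ 2 / κ ^ 2 with ha
  set D : ℝ := 2 * T ^ 2 / κ ^ 2 * C₀ ^ 2 * (L₁ * L₂) * Real.exp (a * T) with hD
  have hD0 : 0 < D := by positivity
  refine ⟨Real.sqrt D, Real.sqrt_pos.2 hD0, ?_⟩
  intro N M₁ M₂ hN hM₁ hM₂ τ h₁ h₂ μ hτ hh₁ hh₂ hμ f hf U u e r he he0 hbd hr heq n hn
  have hNpos : (0:ℝ) < N := by exact_mod_cast hN
  have hM₁pos : (0:ℝ) < M₁ := by exact_mod_cast (by omega : 0 < M₁)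
  have hM₂pos : (0:ℝ) < M₂ := by exact_mod_cast (by omega : 0 < M₂)
  have hτ0 : 0 < τ := by rw [hτ]; positivity
  have hh₁0 : 0 < h₁ := by rw [hh₁]; positivity
  have hh₂0 : 0 < h₂ := by rw [hh₂]; positivity
  have hNT : N * τ = T := by rw [hτ]; field_simp
  have hμ0 : 0 ≤ 1 / (4 * μ) := by
    have : 0 ≤ μ := by
      rw [hμ]
      apply mul_nonneg hΔβ.le
      apply Finset.sum_nonneg
      intro l hl
      have h1 := hΓ l hl
      have h2 := hp l hl
      positivity
    positivity
  set b : ℕ → ℝ := fun k => Δβ * ∑ l ∈ Finset.Icc 1 K,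
    p l * (τ ^ (1 - β l) / Real.Gamma (3 - β l)) * aCoef (β l) k with hb
  have hbanti : ∀ k, b (k+1) ≤ b k := by
    intro k
    apply mul_le_mul_of_nonneg_left _ hΔβ.le
    apply Finset.sum_le_sum
    intro l hl
    have h1 := hΓ l hl
    have h2 := hp l hl
    apply mul_le_mul_of_nonneg_left (aCoef_anti _ (hβ l hl).1 (hβ l hl).2 k)
    positivity
  have hbκ : ∀ k, k < N → κ ≤ b k := by
    intro k hk
    apply mul_le_mul_of_nonneg_left _ hΔβ.le
    apply Finset.sum_le_sum
    intro l hl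
    have h1 := hΓ l hl
    have h2 := hp l hl
    have hkT : ((k:ℝ)+1) * τ ≤ T := by
      rw [← hNT]
      have : (k:ℝ)+1 ≤ N := by exact_mod_cast hk
      gcongr
    have h3 := aCoef_lower (β l) T τ (hβ l hl).1 (hβ l hl).2 hτ0 k hkT
    calc _ ≤ p l * (τ ^ (1 - β l) * aCoef (β l) k / Real.Gamma (3 - β l)) := by gcongr
      _ = _ := by ring
  set w : ℕ → ℕ → ℕ → ℝ := fun n i j => (e n i j - e (n-1) i j) / τ with hwdef
  have hw : ∀ n i j, e n i j - e (n-1) i j = τ * w n i j := by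
    intro n i j
    simp only [hwdef]
    field_simp
  set F : ℕ → ℕ → ℕ → ℝ := fun n i j => f i j (((n : ℝ) - 1) * τ) (U (n - 1) i j)
              - f i j (((n : ℝ) - 1) * τ) (u (n - 1) i j) + r n i j with hFdef
  have h0 : ∀ i j, i ≤ M₁ → j ≤ M₂ → e 0 i j = 0 := by
    intro i j hi hj
    by_cases h : i = 0 ∨ i = M₁ ∨ j = 0 ∨ j = M₂
    · exact hbd 0 (by omega) i j hi hj h
    · exact he0 i j (by omega) (by omega) (by omega) (by omega)
  set R : ℝ := τ + h₁ ^ 2 + h₂ ^ 2 + Δβ ^ 2 with hR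
  have hR0 : 0 ≤ R := by positivity
  have hF : ∀ n : ℕ, 1 ≤ n → n ≤ N → ∀ i j : ℕ, 1 ≤ i → i ≤ M₁ - 1 → 1 ≤ j → j ≤ M₂ - 1 →
      |F n i j| ≤ Lf * |e (n-1) i j| + C₀ * R := by
    intro n h1 h2 i j h3 h4 h5 h6
    have hA := hf i j h3 h4 h5 h6 (((n : ℝ) - 1) * τ) (U (n - 1) i j) (u (n - 1) i j)
    rw [← he] at hA
    exact (abs_add_le _ _).trans (add_le_add hA (hr n h1 h2 i j h3 h4 h5 h6))
  have hen := energy h₁ h₂ (1 / (4 * μ)) τ κ hμ0 hτ0 hκ N M₁ M₂ (by omega) (by omega) e w F b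
    hbanti hbκ hw hbd h0 (by
      intro n h1 h2 i j h3 h4 h5 h6
      have h := heq n h1 h2 i j h3 h4 h5 h6
      have hL : Δβ * (∑ l ∈ Finset.Icc 1 K,
              p l * (τ ^ (1 - β l) / Real.Gamma (3 - β l)) *
                (aCoef (β l) 0 * ((e n i j - e (n - 1) i j) / τ)
                  - (∑ k ∈ Finset.Icc 1 (n - 1),
                      (aCoef (β l) (n - k - 1) - aCoef (β l) (n - k)) *
                        ((e k i j - e (k - 1) i j) / τ))))
          = b 0 * w n i j - ∑ k ∈ Icc 1 (n-1), (b (n-k-1) - b (n-k)) * w k i j := by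
        have hs : ∑ k ∈ Icc 1 (n-1), (b (n-k-1) - b (n-k)) * w k i j
            = Δβ * ∑ l ∈ Finset.Icc 1 K, p l * (τ ^ (1 - β l) / Real.Gamma (3 - β l)) *
              ∑ k ∈ Finset.Icc 1 (n - 1),
                (aCoef (β l) (n - k - 1) - aCoef (β l) (n - k)) * w k i j := by
          simp only [hb, Finset.mul_sum, ← Finset.sum_sub_distrib, Finset.sum_mul]
          rw [Finset.sum_comm]
          refine Finset.sum_congr rfl fun l _ => Finset.sum_congr rfl fun k _ => ?_
          ring
        rw [hs]
        simp only [hb]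
        rw [mul_assoc, ← mul_sub, Finset.sum_mul, ← Finset.sum_sub_distrib]
        congr 1
        refine Finset.sum_congr rfl fun l _ => ?_
        simp only [hwdef]
        ring
      rw [hL] at h
      rw [h]
      simp only [hFdef]
      ring)
  have hrec := norm_rec τ κ T Lf (C₀ * R) hτ0 hκ hT N M₁ M₂ hNT e w F hw h0 hF hen
  have hgr := gronwall_d (fun m => ∑ i ∈ Icc 1 (M₁-1), ∑ j ∈ Icc 1 (M₂-1), e m i j ^ 2)
    (a * τ) _ (by positivity) N hrec n hn
  have hexp : (1 + a * τ) ^ n ≤ Real.exp (a * T) := by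
    have h1 : 1 + a * τ ≤ Real.exp (a * τ) := by linarith [Real.add_one_le_exp (a * τ)]
    have h2 : (n:ℝ) * τ ≤ T := by rw [← hNT]; gcongr
    calc (1 + a * τ) ^ n ≤ Real.exp (a * τ) ^ n := by gcongr
      _ = Real.exp (a * (n * τ)) := by rw [← Real.exp_nat_mul]; congr 1; ring
      _ ≤ _ := by gcongr
  have hc1 : h₁ * ((M₁ - 1 : ℕ) : ℝ) ≤ L₁ := by
    have : ((M₁ - 1 : ℕ) : ℝ) ≤ M₁ := by exact_mod_cast Nat.sub_le _ _
    calc _ ≤ h₁ * M₁ := by gcongr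
      _ = L₁ := by rw [hh₁]; field_simp
  have hc2 : h₂ * ((M₂ - 1 : ℕ) : ℝ) ≤ L₂ := by
    have : ((M₂ - 1 : ℕ) : ℝ) ≤ M₂ := by exact_mod_cast Nat.sub_le _ _
    calc _ ≤ h₂ * M₂ := by gcongr
      _ = L₂ := by rw [hh₂]; field_simp
  rw [Real.sqrt_le_iff]
  refine ⟨by positivity, ?_⟩
  rw [mul_pow, Real.sq_sqrt hD0.le]
  unfold gridNormSq
  calc _ ≤ h₁ * h₂ * (2 * T ^ 2 / κ ^ 2 * (C₀ * R) ^ 2 * ((M₁-1 : ℕ) * (M₂-1 : ℕ))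
          * (1 + a * τ) ^ n) := by
        apply mul_le_mul_of_nonneg_left hgr; positivity
    _ = 2 * T ^ 2 / κ ^ 2 * C₀ ^ 2 * R ^ 2
          * ((h₁ * ((M₁ - 1 : ℕ) : ℝ)) * (h₂ * ((M₂ - 1 : ℕ) : ℝ))) * (1 + a * τ) ^ n := by ring
    _ ≤ 2 * T ^ 2 / κ ^ 2 * C₀ ^ 2 * R ^ 2 * (L₁ * L₂) * Real.exp (a * T) := by gcongr
    _ = _ := by rw [hD]; ring
end
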